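/- Let q be a power of a prime p, j a nonnegative integer, and ρ a permutation of ℕ. Then the set { e ∈ ℕ : S_e(j) ≠ 0 } is finite and nonempty (it contains e = 0), and its maximum equals the maximum of the set { e ∈ ℕ : S_e(ρ_*(j)) ≠ 0 }; that is, the special polynomials z(x,−j) := Σ_e S_e(j) x^{−e} and z(x,−ρ_*(j)) have the same degree in x^{−1}. -/

import Mathlib

open Polynomial

/-- The digit permutation map on natural numbers: if `n = Σ_i c_i q^i` `q`-adically, then
`rhoStar q ρ n = Σ_i c_i q^{ρ(i)}`. -/
def rhoStar (q : ℕ) (ρ : Equiv.Perm ℕ) (n : ℕ) : ℕ :=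
  ∑ i ∈ Finset.range (n + 1), (n / q ^ i % q) * q ^ (ρ i)

section TokenWeights

variable {ι : Type*}

/-- The total weight `∑ p ^ c i` of the elements of `S` whose class `c i` is at most `v`. -/
def lowWeight (p : ℕ) (c : ι → ℕ) (v : ℕ) (S : Finset ι) : ℕ :=
  ∑ i ∈ S with c i ≤ v, p ^ c i

variable {p : ℕ} {c : ι → ℕ}

lemma lowWeight_eq_of_le {v : ℕ} {S : Finset ι} (h : ∀ i ∈ S, c i ≤ v) :
    lowWeight p c v S = ∑ i ∈ S, p ^ c i := by
  rw [lowWeight, Finset.filter_true_of_mem h]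

lemma lowWeight_mono {v : ℕ} {S T : Finset ι} (h : S ⊆ T) :
    lowWeight p c v S ≤ lowWeight p c v T :=
  Finset.sum_le_sum_of_subset (Finset.filter_subset_filter _ h)

lemma lowWeight_union [DecidableEq ι] {v : ℕ} {S T : Finset ι} (h : Disjoint S T) :
    lowWeight p c v (S ∪ T) = lowWeight p c v S + lowWeight p c v T := by
  rw [lowWeight, Finset.filter_union, Finset.sum_union (Finset.disjoint_filter_filter h)]
  rfl

lemma lowWeight_sdiff_add [DecidableEq ι] {v : ℕ} {S T : Finset ι} (h : T ⊆ S) :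
    lowWeight p c v (S \ T) + lowWeight p c v T = lowWeight p c v S := by
  rw [← lowWeight_union Finset.sdiff_disjoint, Finset.sdiff_union_of_subset h]

/-- Powers of `p` not exceeding `p ^ v` with total at least `k * p ^ v` contain a subfamily with
total exactly `k * p ^ v`. -/
lemma exists_subset_sum_pow_eq {v k : ℕ} (S : Finset ι) (hS : ∀ i ∈ S, c i ≤ v)
    (h : k * p ^ v ≤ ∑ i ∈ S, p ^ c i) : ∃ T ⊆ S, ∑ i ∈ T, p ^ c i = k * p ^ v := by
  classical
  induction S using Finset.strongInduction with
  | H S ih =>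
    rcases h.eq_or_lt with h' | h'
    · exact ⟨S, subset_rfl, h'.symm⟩
    have hne : S.Nonempty := by
      rw [Finset.nonempty_iff_ne_empty]
      rintro rfl
      simp at h'
    obtain ⟨i, hi, hmin⟩ := Finset.exists_min_image S c hne
    have hd1 : p ^ c i ∣ ∑ i ∈ S, p ^ c i :=
      Finset.dvd_sum fun j hj => pow_dvd_pow _ (hmin j hj)
    have hd2 : p ^ c i ∣ k * p ^ v := (pow_dvd_pow _ (hS i hi)).mul_left _
    have hle : k * p ^ v + p ^ c i ≤ ∑ i ∈ S, p ^ c i := by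
      have := Nat.le_of_dvd (by omega) (Nat.dvd_sub hd1 hd2)
      omega
    have hsum := Finset.add_sum_erase S (fun i => p ^ c i) hi
    obtain ⟨T, hT, hTs⟩ := ih (S.erase i) (Finset.erase_ssubset hi)
      (fun j hj => hS j (Finset.mem_of_mem_erase hj)) (by omega)
    exact ⟨T, hT.trans (Finset.erase_subset _ _), hTs⟩

/-- A family of powers of `p` contains a subfamily with prescribed weight increments `δ v`, as soon
as the low weights allow it. -/
lemma exists_subset_partial_weight (Q : Finset ι) (δ : ℕ → ℕ)
    (hd : ∀ v, p ^ v ∣ δ v)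
    (h : ∀ v, δ v ≠ 0 → ∑ s ∈ Finset.range (v + 1), δ s ≤ lowWeight p c v Q) (V : ℕ) :
    ∃ A ⊆ Q, (∀ i ∈ A, c i < V) ∧ ∑ i ∈ A, p ^ c i = ∑ s ∈ Finset.range V, δ s ∧
      ∀ v < V, ∑ s ∈ Finset.range (v + 1), δ s ≤ lowWeight p c v A := by
  classical
  induction V with
  | zero => exact ⟨∅, by simp⟩
  | succ V ih =>
    obtain ⟨A, hAQ, hAc, hAw, hA⟩ := ih
    by_cases h0 : δ V = 0
    · refine ⟨A, hAQ, fun i hi => (hAc i hi).trans (Nat.lt_succ_self V), ?_, ?_⟩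
      · rw [Finset.sum_range_succ, h0, hAw, add_zero]
      · intro v hv
        rcases (Nat.lt_succ_iff.mp hv).eq_or_lt with rfl | hv
        · rw [lowWeight_eq_of_le fun i hi => (hAc i hi).le, Finset.sum_range_succ, h0, hAw,
            add_zero]
        · exact hA v hv
    · obtain ⟨k, hk⟩ := hd V
      have hV := h V h0
      have hAV : lowWeight p c V A = ∑ i ∈ A, p ^ c i :=
        lowWeight_eq_of_le fun i hi => (hAc i hi).le
      have hsd := lowWeight_sdiff_add (p := p) (c := c) (v := V) hAQ
      rw [Finset.sum_range_succ] at hV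
      obtain ⟨T, hT, hTs⟩ := exists_subset_sum_pow_eq (p := p) (c := c) (v := V) (k := k)
        ((Q \ A).filter fun i => c i ≤ V) (fun i hi => (Finset.mem_filter.mp hi).2) (by
          change _ ≤ lowWeight p c V (Q \ A)
          rw [mul_comm, ← hk]; omega)
      have hTc : ∀ i ∈ T, c i ≤ V := fun i hi => (Finset.mem_filter.mp (hT hi)).2
      have hTQ : T ⊆ Q \ A := hT.trans (Finset.filter_subset _ _)
      have hdis : Disjoint A T := (Finset.disjoint_of_subset_left hTQ Finset.sdiff_disjoint).symm
      have hw : ∑ i ∈ A ∪ T, p ^ c i = ∑ s ∈ Finset.range (V + 1), δ s := by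
        rw [Finset.sum_union hdis, hTs, hAw, Finset.sum_range_succ, hk, mul_comm k]
      have hc : ∀ i ∈ A ∪ T, c i ≤ V := by
        intro i hi
        rcases Finset.mem_union.mp hi with hi | hi
        exacts [(hAc i hi).le, hTc i hi]
      refine ⟨A ∪ T, Finset.union_subset hAQ (hTQ.trans Finset.sdiff_subset),
        fun i hi => Nat.lt_succ_of_le (hc i hi), hw, ?_⟩
      intro v hv
      rcases (Nat.lt_succ_iff.mp hv).eq_or_lt with rfl | hv
      · rw [lowWeight_eq_of_le hc, hw]
      · exact (hA v hv).trans (lowWeight_mono Finset.subset_union_left)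

/-- In a family of total weight `p ^ n - 1`, the low weights are congruent to `-1`. -/
lemma pow_dvd_lowWeight_add_one {n v : ℕ} (hv : v < n) (S : Finset ι)
    (h : ∑ i ∈ S, p ^ c i + 1 = p ^ n) : p ^ (v + 1) ∣ lowWeight p c v S + 1 := by
  have h1 : p ^ (v + 1) ∣ ∑ i ∈ S with ¬ c i ≤ v, p ^ c i :=
    Finset.dvd_sum fun i hi => pow_dvd_pow _ (by have := (Finset.mem_filter.mp hi).2; omega)
  have h2 := Finset.sum_filter_add_sum_filter_not S (fun i => c i ≤ v) (fun i => p ^ c i)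
  have h3 : p ^ (v + 1) ∣ p ^ n := pow_dvd_pow _ hv
  rw [← h, ← h2] at h3
  refine (Nat.dvd_add_left h1).mp ?_
  convert h3 using 1
  rw [lowWeight]; ring

/-- Distinct digits: if every exponent below `m` occurs fewer than `p` times, then the sum of the
corresponding powers of `p` is less than `p ^ m`. -/
lemma sum_pow_lt_pow (e : ι → ℕ) (S : Finset ι)
    (hmul : ∀ m, (S.filter fun i => e i = m).card < p) (m : ℕ) :
    ∑ i ∈ S with e i < m, p ^ e i < p ^ m := by
  classical
  induction m with
  | zero => simp
  | succ m ih =>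
    have h1 : (S.filter fun i => e i < m + 1)
        = (S.filter fun i => e i < m) ∪ (S.filter fun i => e i = m) := by
      ext i; simp only [Finset.mem_filter, Finset.mem_union]; grind
    have h2 : ∑ i ∈ S with e i = m, p ^ e i = (S.filter fun i => e i = m).card * p ^ m := by
      rw [Finset.sum_congr rfl (g := fun _ => p ^ m)
        (fun i hi => by rw [(Finset.mem_filter.mp hi).2])]
      simp
    rw [h1, Finset.sum_union (by
      rw [Finset.disjoint_filter]; intros; omega), h2, pow_succ]
    have := hmul m
    nlinarith [Nat.mul_le_mul_right (p ^ m) (Nat.succ_le_of_lt this)]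

end TokenWeights

section TokenChains

variable {ι : Type*} [DecidableEq ι]

/-- A chain of token sets `∅ = U 0 ⊆ U 1 ⊆ ⋯ ⊆ U (N + 1) = J` such that `U k` has weight
`k * (q - 1)` for `k ≤ N`. -/
structure IsTokenChain (p q : ℕ) (c : ι → ℕ) (N : ℕ) (J : Finset ι) (U : ℕ → Finset ι) :
    Prop where
  zero : U 0 = ∅
  mono : ∀ k ≤ N, U k ⊆ U (k + 1)
  last : U (N + 1) = J
  weight : ∀ k ≤ N, ∑ i ∈ U k, p ^ c i = k * (q - 1)

/-- The cost of a chain: the sum of the values of the sets `U 0, …, U N`. -/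
def chainCost (p : ℕ) (e : ι → ℕ) (N : ℕ) (U : ℕ → Finset ι) : ℕ :=
  ∑ k ∈ Finset.range (N + 1), ∑ i ∈ U k, p ^ e i

/-- A chain of minimal cost. -/
structure IsMinTokenChain (p q : ℕ) (c e : ι → ℕ) (N : ℕ) (J : Finset ι) (U : ℕ → Finset ι) :
    Prop extends IsTokenChain p q c N J U where
  le_cost : ∀ V, IsTokenChain p q c N J V → chainCost p e N U ≤ chainCost p e N V

variable {p q n N : ℕ} {c e : ι → ℕ} {J : Finset ι} {U : ℕ → Finset ι}

namespace IsTokenChain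

omit [DecidableEq ι] in
lemma subset_of_le (h : IsTokenChain p q c N J U) {a b : ℕ} (hab : a ≤ b) (hb : b ≤ N + 1) :
    U a ⊆ U b := by
  induction b, hab using Nat.le_induction with
  | base => exact subset_rfl
  | succ b hab ih => exact (ih (by omega)).trans (h.mono b (by omega))

omit [DecidableEq ι] in
lemma subset_last (h : IsTokenChain p q c N J U) {a : ℕ} (ha : a ≤ N + 1) : U a ⊆ J :=
  h.last ▸ h.subset_of_le ha le_rfl

lemma bin_weight (h : IsTokenChain p q c N J U) {k : ℕ} (hk : k < N) :
    ∑ i ∈ U (k + 1) \ U k, p ^ c i = q - 1 := by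
  have h1 := Finset.sum_sdiff (f := fun i => p ^ c i) (h.mono k hk.le)
  rw [h.weight k hk.le, h.weight (k + 1) hk] at h1
  rw [add_mul, one_mul] at h1
  omega

lemma dvd_bin_lowWeight (hp : 0 < p) (h : IsTokenChain p (p ^ n) c N J U) {k v : ℕ} (hk : k < N)
    (hv : v < n) : p ^ (v + 1) ∣ lowWeight p c v (U (k + 1) \ U k) + 1 :=
  pow_dvd_lowWeight_add_one hv _ (by
    rw [h.bin_weight hk]
    have := Nat.pow_pos (n := n) hp
    omega)

lemma sum_bin (h : IsTokenChain p q c N J U) (f : ι → ℕ) {k : ℕ} (hk : k ≤ N + 1) :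
    ∑ l ∈ Finset.range k, ∑ i ∈ U (l + 1) \ U l, f i = ∑ i ∈ U k, f i := by
  induction k with
  | zero => simp [h.zero]
  | succ k ih =>
    rw [Finset.sum_range_succ, ih (by omega), add_comm,
      Finset.sum_sdiff (h.mono k (by omega))]

end IsTokenChain

omit [DecidableEq ι] in
lemma sum_lt_of_subset_small (hmul : ∀ m, (J.filter fun i => e i = m).card < p)
    {B : Finset ι} {m : ℕ} (hB : B ⊆ J) (hsm : ∀ i ∈ B, e i < m) :
    ∑ i ∈ B, p ^ e i < p ^ m :=
  (Finset.sum_le_sum_of_subset fun i hi => Finset.mem_filter.mpr ⟨hB hi, hsm i hi⟩).trans_lt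
    (sum_pow_lt_pow e J hmul m)

/-- In a minimal chain, the small tokens of a later bin cannot replace a big token of an earlier
one. -/
lemma IsMinTokenChain.exchange (hU : IsMinTokenChain p q c e N J U) (hp : 0 < p)
    (hmul : ∀ m, (J.filter fun i => e i = m).card < p) {m k k' : ℕ} {τ : ι} (hk : k < k')
    (hk' : k' ≤ N) (hτ : τ ∈ U (k + 1) \ U k) (hm : m ≤ e τ) :
    ∑ i ∈ U (k' + 1) \ U k' with e i < m ∧ c i ≤ c τ, p ^ c i < p ^ c τ := by
  by_contra! hcon
  obtain ⟨B, hB, hBw⟩ := exists_subset_sum_pow_eq (p := p) (c := c) (v := c τ) (k := 1)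
    ((U (k' + 1) \ U k').filter fun i => e i < m ∧ c i ≤ c τ)
    (fun i hi => (Finset.mem_filter.mp hi).2.2) (by rwa [one_mul])
  have hC := hU.toIsTokenChain
  have hBm : ∀ i ∈ B, e i < m := fun i hi => (Finset.mem_filter.mp (hB hi)).2.1
  have hBU : B ⊆ U (k' + 1) := fun i hi =>
    (Finset.mem_sdiff.mp (Finset.mem_filter.mp (hB hi)).1).1
  have hBn : ∀ i ∈ B, i ∉ U k' := fun i hi =>
    (Finset.mem_sdiff.mp (Finset.mem_filter.mp (hB hi)).1).2
  rw [Finset.mem_sdiff] at hτ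
  have hBlt : ∑ i ∈ B, p ^ e i < p ^ e τ :=
    (sum_lt_of_subset_small hmul (hBU.trans (hC.subset_last (by omega))) hBm).trans_le
      (Nat.pow_le_pow_right hp hm)
  have key : ∀ (f : ι → ℕ) l, k < l → l ≤ k' →
      ∑ i ∈ (U l).erase τ ∪ B, f i + f τ = ∑ i ∈ U l, f i + ∑ i ∈ B, f i := by
    intro f l h1 h2
    have hd : Disjoint ((U l).erase τ) B := by
      rw [Finset.disjoint_left]
      intro i hi hiB
      exact hBn i hiB (hC.subset_of_le h2 (by omega) (Finset.mem_of_mem_erase hi))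
    have := Finset.sum_erase_add (U l) f (hC.subset_of_le (a := k + 1) h1 (by omega) hτ.1)
    rw [Finset.sum_union hd]
    omega
  let V : ℕ → Finset ι := fun l => if k < l ∧ l ≤ k' then (U l).erase τ ∪ B else U l
  have hV1 : ∀ l, k < l → l ≤ k' → V l = (U l).erase τ ∪ B := fun l h1 h2 => if_pos ⟨h1, h2⟩
  have hV2 : ∀ l, ¬ (k < l ∧ l ≤ k') → V l = U l := fun l h => if_neg h
  have hV : IsTokenChain p q c N J V := by
    refine ⟨by rw [hV2 0 (by omega), hC.zero], fun l hl => ?_,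
      by rw [hV2 _ (by omega), hC.last], fun l hl => ?_⟩
    · have hm := hC.mono l hl
      by_cases h1 : k < l ∧ l ≤ k'
      · rw [hV1 l h1.1 h1.2]
        by_cases h2 : l + 1 ≤ k'
        · rw [hV1 (l + 1) (by omega) h2]
          exact Finset.union_subset_union_left (Finset.erase_subset_erase _ hm)
        · rw [hV2 (l + 1) (by omega)]
          obtain rfl : l = k' := by omega
          exact Finset.union_subset ((Finset.erase_subset _ _).trans hm) hBU
      · rw [hV2 l h1]
        by_cases h2 : k < l + 1 ∧ l + 1 ≤ k'
        · rw [hV1 (l + 1) h2.1 h2.2]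
          obtain rfl : l = k := by omega
          intro i hi
          refine Finset.mem_union_left _ (Finset.mem_erase.mpr ⟨?_, hm hi⟩)
          rintro rfl
          exact hτ.2 hi
        · rwa [hV2 (l + 1) h2]
    · by_cases h1 : k < l ∧ l ≤ k'
      · rw [hV1 l h1.1 h1.2, ← hC.weight l hl]
        have := key (fun i => p ^ c i) l h1.1 h1.2
        rw [hBw] at this
        omega
      · rw [hV2 l h1, hC.weight l hl]
  refine absurd (hU.le_cost V hV) (not_le.mpr ?_)
  have hlt : ∀ l, k < l → l ≤ k' → ∑ i ∈ V l, p ^ e i < ∑ i ∈ U l, p ^ e i := by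
    intro l h1 h2
    rw [hV1 l h1 h2]
    have := key (fun i => p ^ e i) l h1 h2
    omega
  refine Finset.sum_lt_sum (fun l _ => ?_) ⟨k', Finset.mem_range.mpr (by omega), hlt k' hk le_rfl⟩
  by_cases h1 : k < l ∧ l ≤ k'
  · exact (hlt l h1.1 h1.2).le
  · rw [hV2 l h1]

/-- Dependent choice along an initial segment of the natural numbers. -/
lemma exists_seq_of_step {α : Type*} (R : ℕ → α → Prop) (r : α → α → Prop) (K : ℕ) (x₀ : α)
    (h0 : R 0 x₀) (step : ∀ k < K, ∀ x, R k x → ∃ y, R (k + 1) y ∧ r x y) :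
    ∃ f : ℕ → α, f 0 = x₀ ∧ (∀ k ≤ K, R k (f k)) ∧ ∀ k < K, r (f k) (f (k + 1)) := by
  have step' : ∀ k x, ∃ y, k < K → R k x → R (k + 1) y ∧ r x y := by
    intro k x
    by_cases h : k < K ∧ R k x
    · obtain ⟨y, hy⟩ := step k h.1 x h.2
      exact ⟨y, fun _ _ => hy⟩
    · exact ⟨x, fun h1 h2 => absurd ⟨h1, h2⟩ h⟩
  choose g hg using step'
  let f : ℕ → α := fun k => Nat.rec x₀ g k
  have hR : ∀ k ≤ K, R k (f k) := by
    intro k hk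
    induction k with
    | zero => exact h0
    | succ k ih => exact (hg k (f k) hk (ih (by omega))).1
  exact ⟨f, rfl, hR, fun k hk => (hg k (f k) hk (hR k hk.le)).2⟩

omit [DecidableEq ι] in
/-- Sums over tokens of a function of the exponent, grouped by exponent. -/
lemma sum_eq_sum_card_mul (S : Finset ι) (f : ℕ → ℕ) {M : ℕ} (hM : ∀ i ∈ S, e i < M) :
    ∑ i ∈ S, f (e i) = ∑ m ∈ Finset.range M, (S.filter fun i => e i = m).card * f m := by
  rw [← Finset.sum_fiberwise_of_maps_to (t := Finset.range M) (g := e)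
    (fun i hi => Finset.mem_range.mpr (hM i hi))]
  refine Finset.sum_congr rfl fun m _ => ?_
  rw [Finset.sum_congr rfl (g := fun _ => f m)
    (fun i hi => by rw [(Finset.mem_filter.mp hi).2])]
  simp

lemma lowWeight_image_steps (P : ℕ → Prop) [DecidablePred P] (hP : ∀ b, P b → b < n)
    (β : ℕ → ι) (hβ : ∀ b, P b → c (β b) = b + 1) (v : ℕ) :
    lowWeight p c v (((Finset.range n).filter P).image β)
      = ∑ s ∈ Finset.range v, if P s then p ^ (s + 1) else 0 := by
  rw [lowWeight, Finset.sum_filter, Finset.sum_image]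
  · rw [Finset.sum_congr rfl (g := fun b => if b < v then p ^ (b + 1) else 0)]
    · rw [← Finset.sum_filter, ← Finset.sum_filter, Finset.filter_filter]
      refine Finset.sum_congr ?_ fun _ _ => rfl
      ext b
      simp only [Finset.mem_filter, Finset.mem_range]
      exact ⟨fun h => ⟨h.2.2, h.2.1⟩, fun h => ⟨hP b h.2, h.2, h.1⟩⟩
    · intro b hb
      rw [hβ b (Finset.mem_filter.mp hb).2]
      rfl
  · intro b hb b' hb' h
    have h1 := hβ b (Finset.mem_filter.mp hb).2
    have h2 := hβ b' (Finset.mem_filter.mp hb').2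
    rw [h, h2] at h1
    omega

/-- The weight increments of a family that repairs the levels in `L`. -/
def repairStep (p : ℕ) (L : ℕ → Prop) [DecidablePred L] (v : ℕ) : ℕ :=
  if L v then p ^ (v + 1) - (if 1 ≤ v ∧ L (v - 1) then p ^ v else 0) else 0

lemma dvd_repairStep (L : ℕ → Prop) [DecidablePred L] (v : ℕ) : p ^ v ∣ repairStep p L v := by
  unfold repairStep
  split_ifs
  · exact Nat.dvd_sub (pow_dvd_pow _ (by omega)) dvd_rfl
  · simpa using pow_dvd_pow p (Nat.le_succ v)
  · exact dvd_zero _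

lemma sum_repairStep (hp : 0 < p) (L : ℕ → Prop) [DecidablePred L] (v : ℕ) :
    ∑ s ∈ Finset.range (v + 1), repairStep p L s
      = (∑ s ∈ Finset.range v, if L s ∧ ¬ L (s + 1) then p ^ (s + 1) else 0)
        + if L v then p ^ (v + 1) else 0 := by
  induction v with
  | zero => simp [repairStep]
  | succ v ih =>
    have : p ^ (v + 1) ≤ p ^ (v + 1 + 1) := Nat.pow_le_pow_right hp (by omega)
    rw [Finset.sum_range_succ, ih, Finset.sum_range_succ]
    unfold repairStep
    by_cases h1 : L v <;> by_cases h2 : L (v + 1) <;> simp [h1, h2] <;> omega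

omit [DecidableEq ι] in
lemma lowWeight_add_le_of_counts (hc : ∀ i, c i = e i % n) {G S R : Finset ι} {m v : ℕ}
    (h : ∀ m', (G.filter fun i => e i = m').card + (if m' = m then 1 else 0)
      ≤ (S.filter fun i => e i = m').card + (R.filter fun i => e i = m').card)
    (hv : m % n ≤ v) :
    lowWeight p c v G + p ^ (m % n) ≤ lowWeight p c v S + lowWeight p c v R := by
  classical
  obtain ⟨M, hM⟩ : ∃ M, (∀ i ∈ G ∪ S ∪ R, e i < M) ∧ m < M :=
    ⟨(G ∪ S ∪ R).sup e + m + 1, fun i hi => by have := Finset.le_sup (f := e) hi; omega, by omega⟩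
  have key : ∀ X : Finset ι, (∀ i ∈ X, e i < M) → lowWeight p c v X
      = ∑ m' ∈ Finset.range M, (X.filter fun i => e i = m').card
        * (if m' % n ≤ v then p ^ (m' % n) else 0) := by
    intro X hX
    rw [← sum_eq_sum_card_mul X (fun a => if a % n ≤ v then p ^ (a % n) else 0) hX, lowWeight,
      Finset.sum_filter]
    simp only [hc]
  have hm : p ^ (m % n) = ∑ m' ∈ Finset.range M, (if m' = m then 1 else 0)
      * (if m' % n ≤ v then p ^ (m' % n) else 0) := by
    rw [Finset.sum_eq_single m (fun b _ hb => by simp [hb])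
      (fun h => absurd (Finset.mem_range.mpr hM.2) h)]
    simp [hv]
  rw [key G fun i hi => hM.1 i (by simp [hi]), key S fun i hi => hM.1 i (by simp [hi]),
    key R fun i hi => hM.1 i (by simp [hi]), hm, ← Finset.sum_add_distrib,
    ← Finset.sum_add_distrib]
  refine Finset.sum_le_sum fun v _ => ?_
  rw [← add_mul, ← add_mul]
  exact Nat.mul_le_mul_right _ (h v)

/-- If the last cut of a minimal chain carries more tokens of exponent `m` than an admissible
competitor `G` agreeing with it above `m`, then there is a small token `z` of the last bin and a
big token `T` of an earlier bin between whose classes all levels are overfull. -/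
lemma IsMinTokenChain.exists_overfull_levels (hU : IsMinTokenChain p (p ^ n) c e N J U)
    (hp : 0 < p) (hn : 0 < n) (hc : ∀ i, c i = e i % n)
    (hmul : ∀ m, (J.filter fun i => e i = m).card < p)
    {G : Finset ι} (hGw : ∑ i ∈ G, p ^ c i = N * (p ^ n - 1))
    (hGl : ∀ v < n, N * (p ^ (v + 1) - 1) ≤ lowWeight p c v G)
    (hGJ : ∀ m, (G.filter fun i => e i = m).card ≤ (J.filter fun i => e i = m).card)
    {m : ℕ} (hm : (G.filter fun i => e i = m).card < ((U N).filter fun i => e i = m).card)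
    (hm' : ∀ m' > m, (G.filter fun i => e i = m').card
      = ((U N).filter fun i => e i = m').card) :
    ∃ (t u k : ℕ) (z T : ι), t < u ∧ u < n ∧ k < N ∧ z ∈ U (N + 1) \ U N ∧ e z < m ∧ c z = u ∧
      T ∈ U (k + 1) \ U k ∧ m ≤ e T ∧ c T = t ∧
      (∀ τ ∈ U N, m ≤ e τ → t < c τ → ¬ c τ ≤ u) ∧
      ∀ v, t ≤ v → v < u → ∃ k < N, 2 * p ^ (v + 1) ≤ lowWeight p c v (U (k + 1) \ U k) + 1 := by
  have hC := hU.toIsTokenChain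
  have hcn : ∀ i, c i < n := fun i => hc i ▸ Nat.mod_lt _ hn
  have hbin : ∀ τ ∈ U N, ∃ k < N, τ ∈ U (k + 1) \ U k := by
    intro τ hτ
    have h0 : ∃ k, τ ∈ U k := ⟨N, hτ⟩
    classical
    have h1 := Nat.find_spec h0
    have h2 : Nat.find h0 ≠ 0 := by
      intro h; rw [h, hC.zero] at h1; simp at h1
    have h3 : Nat.find h0 ≤ N := Nat.find_min' h0 hτ
    refine ⟨Nat.find h0 - 1, by omega, Finset.mem_sdiff.mpr ⟨?_, ?_⟩⟩
    · rwa [Nat.sub_add_cancel (by omega)]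
    · exact Nat.find_min h0 (by omega)
  obtain ⟨τ₀, hτ₀⟩ : ((U N).filter fun i => e i = m).Nonempty := by
    rw [← Finset.card_pos]; omega
  rw [Finset.mem_filter] at hτ₀
  obtain ⟨k₀, hk₀, hk₀'⟩ := hbin τ₀ hτ₀.1
  have hcτ₀ : c τ₀ = m % n := by rw [hc, hτ₀.2]
  have hsm0 := hU.exchange hp hmul hk₀ le_rfl hk₀' hτ₀.2.ge
  rw [hcτ₀] at hsm0
  have hcount : ∀ v, m % n ≤ v → lowWeight p c v G + p ^ (m % n)
      ≤ lowWeight p c v (U N) + lowWeight p c v ((U (N + 1) \ U N).filter fun i => e i < m) := by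
    intro v hv
    refine lowWeight_add_le_of_counts hc (fun m' => ?_) hv
    rcases lt_trichotomy m' m with h | rfl | h
    · rw [if_neg h.ne]
      refine (hGJ m').trans ?_
      rw [← hC.last, Finset.filter_filter, ← Finset.card_union_of_disjoint]
      · refine Finset.card_le_card fun i hi => ?_
        rw [Finset.mem_filter] at hi
        by_cases hiN : i ∈ U N
        · simp [hiN, hi.2]
        · simp [hiN, hi.1, hi.2, h]
      · rw [Finset.disjoint_left]
        intro i hi hi'
        simp only [Finset.mem_filter, Finset.mem_sdiff] at hi hi'
        exact hi'.1.2 hi.1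
    · rw [if_pos rfl]; omega
    · rw [if_neg h.ne', hm' m' h]; omega
  have hstrict : ∀ v, m % n ≤ v →
      (∀ i ∈ U (N + 1) \ U N, e i < m → c i ≤ v → c i ≤ m % n) →
      lowWeight p c v G < lowWeight p c v (U N) := by
    intro v hv h
    have h1 : lowWeight p c v ((U (N + 1) \ U N).filter fun i => e i < m) < p ^ (m % n) := by
      refine lt_of_le_of_lt ?_ hsm0
      rw [lowWeight, Finset.filter_filter]
      refine Finset.sum_le_sum_of_subset fun i hi => ?_
      rw [Finset.mem_filter] at hi ⊢
      exact ⟨hi.1, hi.2.1, h i hi.1 hi.2.1 hi.2.2⟩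
    have := hcount v hv
    omega
  have hex : ∃ u, ∃ z ∈ U (N + 1) \ U N, e z < m ∧ m % n < c z ∧ c z = u := by
    by_contra! hcon
    have := hstrict n (Nat.mod_lt _ hn).le fun i hi hi' _ => by
      by_contra! hlt
      exact hcon _ i hi hi' hlt rfl
    rw [lowWeight_eq_of_le fun i _ => (hcn i).le, lowWeight_eq_of_le fun i _ => (hcn i).le, hGw,
      hC.weight N le_rfl] at this
    omega
  classical
  obtain ⟨z, hz, hzm, htz, hzu⟩ := Nat.find_spec hex
  have humin : ∀ i ∈ U (N + 1) \ U N, e i < m → m % n < c i → Nat.find hex ≤ c i :=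
    fun i hi him hti => Nat.find_min' hex ⟨i, hi, him, hti, rfl⟩
  set u := Nat.find hex with hu
  obtain ⟨T, hT, hTmax⟩ := Finset.exists_max_image
    ((U N).filter fun i => m ≤ e i ∧ c i < u) c
    ⟨τ₀, Finset.mem_filter.mpr ⟨hτ₀.1, hτ₀.2.ge, by omega⟩⟩
  have htT : m % n ≤ c T := hcτ₀ ▸ hTmax τ₀
    (Finset.mem_filter.mpr ⟨hτ₀.1, hτ₀.2.ge, by omega⟩)
  rw [Finset.mem_filter] at hT
  obtain ⟨k, hk, hTk⟩ := hbin T hT.1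
  refine ⟨c T, u, k, z, T, hT.2.2, hzu ▸ hcn z, hk, hz, hzm, hzu, hTk, hT.2.1, rfl, ?_, ?_⟩
  · intro τ hτ hτm hlt hle
    rcases hle.lt_or_eq with h | h
    · have := hTmax τ (Finset.mem_filter.mpr ⟨hτ, hτm, h⟩)
      omega
    · obtain ⟨k', hk', hτk'⟩ := hbin τ hτ
      have h1 := hU.exchange hp hmul hk' le_rfl hτk' hτm
      have h2 := Finset.single_le_sum (f := fun i => p ^ c i)
        (s := (U (N + 1) \ U N).filter fun i => e i < m ∧ c i ≤ c τ) (fun _ _ => Nat.zero_le _)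
        (Finset.mem_filter.mpr ⟨hz, hzm, by omega⟩)
      simp only [hzu, ← h] at h2
      omega
  · intro v htv hvu
    by_contra! hcon
    have h1 := hstrict v (htT.trans htv) fun i hi him hiv => by
      by_contra! hlt
      have := humin i hi him hlt
      omega
    have hvn : v < n := by have := hcn z; omega
    have h2 : ∀ l ∈ Finset.range N, lowWeight p c v (U (l + 1) \ U l) = p ^ (v + 1) - 1 := by
      intro l hl
      rw [Finset.mem_range] at hl
      obtain ⟨a, ha⟩ := hC.dvd_bin_lowWeight hp hl hvn
      have h3 := hcon l hl
      rw [ha, mul_comm] at h3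
      have h4 : a < 2 := lt_of_mul_lt_mul_right h3 (Nat.zero_le _)
      have h5 : a ≠ 0 := by rintro rfl; omega
      obtain rfl : a = 1 := by omega
      omega
    have h3 := hC.sum_bin (fun i => if c i ≤ v then p ^ c i else 0) (Nat.le_succ N)
    simp only [← Finset.sum_filter] at h3
    change ∑ l ∈ Finset.range N, lowWeight p c v (U (l + 1) \ U l) = lowWeight p c v (U N) at h3
    rw [Finset.sum_congr rfl h2] at h3
    simp only [Finset.sum_const, Finset.card_range, smul_eq_mul] at h3
    have := hGl v hvn
    omega

lemma sum_pow_sub_pow (hp : 0 < p) {t u : ℕ} (htu : t ≤ u) (w : ℕ) :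
    (∑ s ∈ Finset.range w, if t ≤ s ∧ s < u then p ^ (s + 1) - p ^ s else 0) + p ^ t
      = p ^ max t (min w u) := by
  induction w with
  | zero => simp
  | succ w ih =>
    rw [Finset.sum_range_succ, add_right_comm, ih]
    have h1 : p ^ w ≤ p ^ (w + 1) := Nat.pow_le_pow_right hp (by omega)
    by_cases h : t ≤ w ∧ w < u
    · rw [if_pos h, min_eq_left h.2.le, max_eq_right h.1, min_eq_left (by omega : w + 1 ≤ u),
        max_eq_right (by omega)]
      omega
    · rw [if_neg h, add_zero]
      congr 1
      omega

/-- A minimal chain cannot have all levels between the classes of a small token of the last bin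
and of a big token of an earlier bin overfull: otherwise the bins could be repaired at a lower
cost. -/
lemma IsMinTokenChain.not_overfull_levels (hU : IsMinTokenChain p (p ^ n) c e N J U)
    (hp : 2 ≤ p) (hcn : ∀ i, c i < n) (hmul : ∀ m, (J.filter fun i => e i = m).card < p)
    {m t u k₀ : ℕ} {z T : ι} (htu : t < u) (hun : u < n) (hk₀ : k₀ < N)
    (hz : z ∈ U (N + 1) \ U N) (hzm : e z < m) (hzu : c z = u)
    (hT : T ∈ U (k₀ + 1) \ U k₀) (hTm : m ≤ e T) (hTt : c T = t)
    (hbig : ∀ τ ∈ U N, m ≤ e τ → t < c τ → ¬ c τ ≤ u)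
    (hover : ∀ v, t ≤ v → v < u →
      ∃ k < N, 2 * p ^ (v + 1) ≤ lowWeight p c v (U (k + 1) \ U k) + 1) : False := by
  classical
  have hp0 : 0 < p := by omega
  have hC := hU.toIsTokenChain
  let L : ℕ → ℕ → Prop := fun k v => t ≤ v ∧ v < u ∧
    ∀ k', k ≤ k' → k' < N → lowWeight p c v (U (k' + 1) \ U k') + 1 = p ^ (v + 1)
  have hL0 : ∀ v, ¬ L 0 v := by
    rintro v ⟨h1, h2, h3⟩
    obtain ⟨k, hk, hk'⟩ := hover v h1 h2
    rw [h3 k (Nat.zero_le _) hk] at hk'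
    have := Nat.pow_pos (n := v + 1) hp0
    omega
  have hβ : ∀ k b, ∃ x, k < N → L k b → x ∈ U (k + 1) \ U k ∧ e x < m ∧ c x = b + 1 := by
    intro k b
    by_cases h : k < N ∧ L k b
    · obtain ⟨hk, hL⟩ := h
      by_contra! hcon
      have hno : ∀ x ∈ U (k + 1) \ U k, c x ≠ b + 1 := by
        intro x hx hxb
        obtain ⟨-, -, h3⟩ := hcon x
        refine h3 hx ?_ hxb
        by_contra! hm
        refine hbig x ?_ hm (by have := hL.1; omega) (by have := hL.2.1; omega)
        exact hC.subset_of_le hk (by omega) (Finset.mem_sdiff.mp hx).1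
      have h1 : lowWeight p c (b + 1) (U (k + 1) \ U k) = lowWeight p c b (U (k + 1) \ U k) := by
        rw [lowWeight, lowWeight]
        congr 1
        refine Finset.filter_congr fun x hx => ?_
        have := hno x hx
        omega
      have h2 := hC.dvd_bin_lowWeight hp0 hk (v := b + 1) (by have := hL.2.1; omega)
      rw [h1, hL.2.2 k le_rfl hk] at h2
      have h3 := Nat.le_of_dvd (Nat.pow_pos hp0) h2
      have h4 := Nat.pow_lt_pow_right (a := p) (by omega) (by omega : b + 1 < b + 1 + 1)
      omega
    · exact ⟨z, fun h1 h2 => absurd ⟨h1, h2⟩ h⟩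
  choose β hβ using hβ
  let P : ℕ → ℕ → Prop := fun k b => k < N ∧ L k b ∧ ¬ L k (b + 1)
  let B : ℕ → Finset ι := fun k => ((Finset.range n).filter (P k)).image (β k)
  have hB : ∀ k, B k ⊆ (U (k + 1) \ U k).filter fun i => e i < m := by
    intro k x hx
    obtain ⟨b, hb, rfl⟩ := Finset.mem_image.mp hx
    obtain ⟨h1, h2, -⟩ := (Finset.mem_filter.mp hb).2
    obtain ⟨h3, h4, -⟩ := hβ k b h1 h2
    exact Finset.mem_filter.mpr ⟨h3, h4⟩
  have hBU : ∀ k, B k ⊆ U (k + 1) := fun k x hx =>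
    (Finset.mem_sdiff.mp (Finset.mem_filter.mp (hB k hx)).1).1
  have hBdis : ∀ k, Disjoint (U k) (B k) := fun k => Finset.disjoint_left.mpr fun x hx hx' =>
    (Finset.mem_sdiff.mp (Finset.mem_filter.mp (hB k hx')).1).2 hx
  have hBlow : ∀ k < N, ∀ v, lowWeight p c v (B k) + (if L k v then p ^ (v + 1) else 0)
      = ∑ s ∈ Finset.range (v + 1), repairStep p (L k) s := by
    intro k hk v
    rw [sum_repairStep hp0, lowWeight_image_steps (P k)
      (fun b hb => hb.2.1.2.1.trans hun) (β k) (fun b hb => (hβ k b hb.1 hb.2.1).2.2)]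
    simp only [P, hk, true_and]
  have hgain : ∀ l < N, ∀ X : Finset ι,
      (∀ v < n, lowWeight p c v X + (if L l v then p ^ (v + 1) else 0) ≤ lowWeight p c v (U l)) →
      ∀ v, L (l + 1) v → lowWeight p c v X + p ^ (v + 1) ≤ lowWeight p c v (U (l + 1)) := by
    intro l hl X hX v hv
    have hvn : v < n := hv.2.1.trans hun
    have h1 := hX v hvn
    have h2 := lowWeight_sdiff_add (p := p) (c := c) (v := v) (hC.mono l hl.le)
    by_cases h : L l v
    · rw [if_pos h] at h1
      omega
    · rw [if_neg h] at h1
      have h3 : lowWeight p c v (U (l + 1) \ U l) + 1 ≠ p ^ (v + 1) := by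
        intro h3
        refine h ⟨hv.1, hv.2.1, fun k' hk' hkN => ?_⟩
        rcases hk'.eq_or_lt with rfl | hlt
        · exact h3
        · exact hv.2.2 k' hlt hkN
      obtain ⟨a, ha⟩ := hC.dvd_bin_lowWeight hp0 hl hvn
      have h4 : 2 ≤ a := by
        by_contra! h4
        interval_cases a
        · omega
        · omega
      have h5 := Nat.mul_le_mul_left (p ^ (v + 1)) h4
      have h6 := Nat.pow_pos (n := v + 1) hp0
      omega
  let R : ℕ → Finset ι → Prop := fun l X => X ⊆ U l ∪ B l ∧
    ∑ i ∈ X, p ^ c i = l * (p ^ n - 1) ∧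
    ∀ v < n, lowWeight p c v X + (if L l v then p ^ (v + 1) else 0) ≤ lowWeight p c v (U l)
  have hRsub : ∀ l ≤ N, ∀ X, R l X → X ⊆ U (l + 1) := fun l hl X hX =>
    hX.1.trans (Finset.union_subset (hC.mono l hl) (hBU l))
  have hR0 : R 0 ∅ := ⟨by simp, by simp, fun v _ => by simp [hL0, lowWeight]⟩
  have hstep : ∀ l < N - 1, ∀ X, R l X → ∃ Y, R (l + 1) Y ∧ X ⊆ Y := by
    intro l hl X hX
    have hXU := hRsub l (by omega) X hX
    have hXQ : X ⊆ U (l + 1) ∪ B (l + 1) := hXU.trans Finset.subset_union_left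
    obtain ⟨A, hA, -, hAw, hAl⟩ := exists_subset_partial_weight (p := p) (c := c)
      ((U (l + 1) ∪ B (l + 1)) \ X) (repairStep p (L (l + 1))) (dvd_repairStep _) (by
        intro v hv
        have hLv : L (l + 1) v := by
          by_contra h
          simp [repairStep, h] at hv
        rw [← hBlow (l + 1) (by omega), if_pos hLv]
        have h1 := hgain l (by omega) X hX.2.2 v hLv
        have h2 := lowWeight_sdiff_add (p := p) (c := c) (v := v) hXQ
        rw [lowWeight_union (hBdis (l + 1))] at h2
        omega) n
    have hAQ : A ⊆ U (l + 1) ∪ B (l + 1) := hA.trans Finset.sdiff_subset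
    have hAB : ∑ i ∈ A, p ^ c i = ∑ i ∈ B (l + 1), p ^ c i := by
      obtain ⟨n', rfl⟩ : ∃ n', n = n' + 1 := ⟨n - 1, by omega⟩
      have hn' : ¬ L (l + 1) n' := fun h => by have := h.2.1; omega
      rw [hAw, ← hBlow (l + 1) (by omega), if_neg hn', add_zero,
        lowWeight_eq_of_le fun i _ => Nat.lt_succ_iff.mp (hcn i)]
    refine ⟨(U (l + 1) ∪ B (l + 1)) \ A, ⟨Finset.sdiff_subset, ?_, ?_⟩, ?_⟩
    · have h1 := Finset.sum_sdiff (f := fun i => p ^ c i) hAQ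
      rw [Finset.sum_union (hBdis (l + 1)), hC.weight (l + 1) (by omega), hAB] at h1
      omega
    · intro v hv
      have h1 := lowWeight_sdiff_add (p := p) (c := c) (v := v) hAQ
      rw [lowWeight_union (hBdis (l + 1))] at h1
      have h2 := hAl v hv
      rw [← hBlow (l + 1) (by omega)] at h2
      omega
    · intro x hx
      refine Finset.mem_sdiff.mpr ⟨hXQ hx, fun hxA => ?_⟩
      exact (Finset.mem_sdiff.mp (hA hxA)).2 hx
  obtain ⟨f, hf0, hfR, hfm⟩ := exists_seq_of_step R (· ⊆ ·) (N - 1) ∅ hR0 hstep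
  obtain ⟨K, rfl⟩ : ∃ K, N = K + 1 := ⟨N - 1, by omega⟩
  rw [Nat.add_sub_cancel] at hfR hfm
  -- a family of big tokens of the bin `K` of weight `p ^ t`
  obtain ⟨S, hS, hSm, hSt, hSw⟩ : ∃ S ⊆ U (K + 1) \ U K, (∀ i ∈ S, m ≤ e i) ∧ (∀ i ∈ S, c i ≤ t) ∧
      ∑ i ∈ S, p ^ c i = p ^ t := by
    rcases (Nat.lt_succ_iff.mp hk₀).eq_or_lt with rfl | hk
    · exact ⟨{T}, by simpa using hT, by simpa using hTm, by simp [hTt], by simp [hTt]⟩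
    · have h1 := hU.exchange hp0 hmul hk (by omega) hT hTm
      rw [hTt] at h1
      have h2 := Nat.le_of_dvd (by omega)
        (hC.dvd_bin_lowWeight hp0 (k := K) (by omega) (htu.trans hun))
      have h3 := Nat.mul_le_mul_left (p ^ t) hp
      rw [← pow_succ] at h3
      have h4 := Finset.sum_filter_add_sum_filter_not
        ((U (K + 1) \ U K).filter fun i => c i ≤ t) (fun i => e i < m) (fun i => p ^ c i)
      rw [Finset.filter_filter, Finset.filter_filter] at h4
      change _ = lowWeight p c t (U (K + 1) \ U K) at h4
      simp only [and_comm (a := c _ ≤ t)] at h4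
      obtain ⟨S, hS, hSw⟩ := exists_subset_sum_pow_eq (p := p) (c := c) (v := t) (k := 1)
        ((U (K + 1) \ U K).filter fun i => ¬ e i < m ∧ c i ≤ t)
        (fun i hi => (Finset.mem_filter.mp hi).2.2) (by omega)
      refine ⟨S, hS.trans (Finset.filter_subset _ _), fun i hi => ?_, fun i hi => ?_, by omega⟩
      · exact not_lt.mp (Finset.mem_filter.mp (hS hi)).2.1
      · exact (Finset.mem_filter.mp (hS hi)).2.2
  -- the last cut
  rw [Finset.mem_sdiff] at hz
  have hRK := hfR K le_rfl
  have hfKU := hRsub K (by omega) _ hRK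
  have hdz : Disjoint (U (K + 1)) {z} := by simpa using hz.2
  have hSf : Disjoint S (f K) := by
    rw [Finset.disjoint_left]
    intro x hx hx'
    rcases Finset.mem_union.mp (hRK.1 hx') with h | h
    · exact (Finset.mem_sdiff.mp (hS hx)).2 h
    · have := (Finset.mem_filter.mp (hB K h)).2
      have := hSm x hx
      omega
  have hSU : S ⊆ U (K + 1) := hS.trans Finset.sdiff_subset
  have hfz : f K ∪ S ⊆ U (K + 1) ∪ {z} :=
    (Finset.union_subset hfKU hSU).trans Finset.subset_union_left
  obtain ⟨A, hA, -, hAw, -⟩ := exists_subset_partial_weight (p := p) (c := c)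
    ((U (K + 1) ∪ {z}) \ (f K ∪ S))
    (fun v => if t ≤ v ∧ v < u then p ^ (v + 1) - p ^ v else 0) (by
      intro v
      split_ifs
      · exact Nat.dvd_sub (pow_dvd_pow _ (by omega)) dvd_rfl
      · exact dvd_zero _) (by
      intro v hv
      have htv : t ≤ v ∧ v < u := by
        by_contra h
        exact hv (if_neg h)
      have hL : L (K + 1) v := ⟨htv.1, htv.2, fun k' h1 h2 => by omega⟩
      have h1 := hgain K (by omega) _ hRK.2.2 v hL
      have h2 := lowWeight_sdiff_add (p := p) (c := c) (v := v) hfz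
      rw [lowWeight_union hdz, lowWeight_union hSf.symm,
        lowWeight_eq_of_le (S := S) fun i hi => (hSt i hi).trans htv.1, hSw] at h2
      have h3 := sum_pow_sub_pow hp0 htu.le (v + 1)
      rw [min_eq_left (by omega), max_eq_right (by omega)] at h3
      omega) n
  have hAS : Disjoint A S := Finset.disjoint_left.mpr fun x hx hxS =>
    (Finset.mem_sdiff.mp (hA hx)).2 (Finset.mem_union_right _ hxS)
  have hAf : Disjoint (f K) (A ∪ S) := Finset.disjoint_union_right.mpr
    ⟨Finset.disjoint_left.mpr fun x hx hxA =>
      (Finset.mem_sdiff.mp (hA hxA)).2 (Finset.mem_union_left _ hx), hSf.symm⟩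
  have hASw : ∑ i ∈ A ∪ S, p ^ c i = p ^ u := by
    have h3 := sum_pow_sub_pow hp0 htu.le n
    rw [min_eq_right hun.le, max_eq_right htu.le] at h3
    rw [Finset.sum_union hAS, hAw, hSw, h3]
  have hASz : A ∪ S ⊆ U (K + 1) ∪ {z} :=
    Finset.union_subset (hA.trans Finset.sdiff_subset) (hSU.trans Finset.subset_union_left)
  let Z : Finset ι := (U (K + 1) ∪ {z}) \ (A ∪ S)
  have hZ : ∀ g : ι → ℕ, ∑ i ∈ Z, g i + ∑ i ∈ A ∪ S, g i = ∑ i ∈ U (K + 1), g i + g z := by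
    intro g
    rw [Finset.sum_sdiff hASz, Finset.sum_union hdz, Finset.sum_singleton]
  let V : ℕ → Finset ι := fun l => if l ≤ K then f l else if l = K + 1 then Z else J
  have hV1 : ∀ l ≤ K, V l = f l := fun l hl => if_pos hl
  have hV2 : V (K + 1) = Z := by simp [V]
  have hV3 : V (K + 1 + 1) = J := by simp [V]
  have hV : IsTokenChain p (p ^ n) c (K + 1) J V := by
    refine ⟨by rw [hV1 0 (by omega), hf0], fun l hl => ?_, hV3, fun l hl => ?_⟩
    · rcases lt_trichotomy l K with h | rfl | h
      · rw [hV1 l h.le, hV1 (l + 1) h]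
        exact hfm l h
      · rw [hV1 l le_rfl, hV2]
        intro x hx
        refine Finset.mem_sdiff.mpr ⟨Finset.mem_union_left _ (hfKU hx), ?_⟩
        exact Finset.disjoint_left.mp hAf hx
      · obtain rfl : l = K + 1 := by omega
        rw [hV2, hV3]
        refine Finset.sdiff_subset.trans (Finset.union_subset (hC.subset_last (by omega)) ?_)
        rw [← hC.last]
        simpa using hz.1
    · rcases hl.lt_or_eq with h | rfl
      · rw [hV1 l (by omega), (hfR l (by omega)).2.1]
      · have h1 := hZ fun i => p ^ c i
        rw [hASw, hzu, hC.weight _ le_rfl] at h1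
        rw [hV2]
        omega
  refine absurd (hU.le_cost V hV) (not_le.mpr ?_)
  -- comparison of the costs
  have hcostl : ∀ l ∈ Finset.range (K + 1), ∑ i ∈ V l, p ^ e i
      ≤ ∑ i ∈ U l, p ^ e i + ∑ i ∈ U (l + 1) \ U l with e i < m, p ^ e i := by
    intro l hl
    rw [Finset.mem_range] at hl
    rw [hV1 l (by omega)]
    refine (Finset.sum_le_sum_of_subset (hfR l (by omega)).1).trans ?_
    rw [Finset.sum_union (hBdis l)]
    exact Nat.add_le_add_left (Finset.sum_le_sum_of_subset (hB l)) _
  have hcostN : ∑ i ∈ V (K + 1), p ^ e i + p ^ m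
      ≤ ∑ i ∈ U (K + 1), p ^ e i + ∑ i ∈ U (K + 1 + 1) \ U (K + 1) with e i < m, p ^ e i := by
    rw [hV2]
    have h1 := hZ fun i => p ^ e i
    obtain ⟨x, hx⟩ : S.Nonempty := by
      rw [Finset.nonempty_iff_ne_empty]
      rintro rfl
      have := Nat.pow_pos (n := t) hp0
      simp at hSw
      omega
    have h2 : p ^ m ≤ ∑ i ∈ A ∪ S, p ^ e i :=
      (Nat.pow_le_pow_right hp0 (hSm x hx)).trans
        (Finset.single_le_sum (f := fun i => p ^ e i) (fun _ _ => Nat.zero_le _)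
          (Finset.mem_union_right _ hx))
    have h3 : p ^ e z ≤ ∑ i ∈ U (K + 1 + 1) \ U (K + 1) with e i < m, p ^ e i :=
      Finset.single_le_sum (f := fun i => p ^ e i) (fun _ _ => Nat.zero_le _)
        (Finset.mem_filter.mpr ⟨Finset.mem_sdiff.mpr hz, hzm⟩)
    omega
  have hsmall : ∑ l ∈ Finset.range (K + 1 + 1), ∑ i ∈ U (l + 1) \ U l with e i < m, p ^ e i
      < p ^ m := by
    have h1 := hC.sum_bin (fun i => if e i < m then p ^ e i else 0) (k := K + 1 + 1) le_rfl
    simp only [← Finset.sum_filter] at h1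
    rw [h1, hC.last]
    exact sum_pow_lt_pow e J hmul m
  rw [Finset.sum_range_succ] at hsmall
  have h1 := Finset.sum_le_sum hcostl
  rw [Finset.sum_add_distrib] at h1
  rw [chainCost, chainCost, Finset.sum_range_succ _ (K + 1), Finset.sum_range_succ _ (K + 1)]
  omega

omit [DecidableEq ι] in
/-- Forgetting the last bin preserves minimality. -/
lemma IsMinTokenChain.truncate (hU : IsMinTokenChain p q c e (N + 1) J U) :
    IsMinTokenChain p q c e N (U (N + 1)) U := by
  have hC := hU.toIsTokenChain
  refine ⟨⟨hC.zero, fun k hk => hC.mono k (by omega), rfl, fun k hk => hC.weight k (by omega)⟩,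
    fun V hV => ?_⟩
  let V' : ℕ → Finset ι := fun l => if l ≤ N + 1 then V l else J
  have h1 : ∀ l ≤ N + 1, V' l = V l := fun l hl => if_pos hl
  have h2 : V' (N + 1 + 1) = J := if_neg (by omega)
  have hV' : IsTokenChain p q c (N + 1) J V' := by
    refine ⟨by rw [h1 0 (by omega), hV.zero], fun k hk => ?_, h2, fun k hk => ?_⟩
    · rw [h1 k hk]
      rcases hk.eq_or_lt with rfl | hk
      · rw [h2, hV.last]
        exact hC.subset_last (by omega)
      · rw [h1 (k + 1) hk]
        exact hV.mono k (by omega)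
    · rw [h1 k hk]
      rcases hk.eq_or_lt with rfl | hk
      · rw [hV.last]
        exact hC.weight _ le_rfl
      · exact hV.weight k (by omega)
  have h3 := hU.le_cost V' hV'
  rw [chainCost, chainCost, Finset.sum_range_succ _ (N + 1), Finset.sum_range_succ _ (N + 1),
    h1 _ le_rfl, hV.last] at h3
  have h4 : ∀ l ∈ Finset.range (N + 1), ∑ i ∈ V' l, p ^ e i = ∑ i ∈ V l, p ^ e i := fun l hl => by
    rw [h1 l (Finset.mem_range.mp hl).le]
  rw [Finset.sum_congr rfl h4] at h3
  rw [chainCost, chainCost]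
  omega

lemma IsTokenChain.le_lowWeight (hC : IsTokenChain p (p ^ n) c N J U) (hp : 0 < p) {v : ℕ}
    (hv : v < n) : N * (p ^ (v + 1) - 1) ≤ lowWeight p c v (U N) := by
  have h3 := hC.sum_bin (fun i => if c i ≤ v then p ^ c i else 0) (Nat.le_succ N)
  simp only [← Finset.sum_filter] at h3
  rw [lowWeight, ← h3]
  conv_lhs => rw [← Finset.card_range N]
  refine Finset.card_nsmul_le_sum _ _ _ fun l hl => ?_
  have h1 := Nat.le_of_dvd (by omega) (hC.dvd_bin_lowWeight hp (Finset.mem_range.mp hl) hv)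
  rw [lowWeight] at h1
  omega

lemma IsMinTokenChain.not_card_lt {J' : Finset ι} {U' : ℕ → Finset ι}
    (hU : IsMinTokenChain p (p ^ n) c e N J U) (hU' : IsTokenChain p (p ^ n) c N J' U')
    (hp : 2 ≤ p) (hn : 0 < n) (hc : ∀ i, c i = e i % n)
    (hmul : ∀ m, (J.filter fun i => e i = m).card < p)
    (hJ : ∀ m, (J.filter fun i => e i = m).card = (J'.filter fun i => e i = m).card)
    {m : ℕ} (hm' : ∀ m' > m, ((U' N).filter fun i => e i = m').card
      = ((U N).filter fun i => e i = m').card) :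
    ¬ ((U' N).filter fun i => e i = m).card < ((U N).filter fun i => e i = m).card := by
  intro hm
  obtain ⟨t, u, k, z, T, htu, hun, hk, hz, hzm, hzu, hT, hTm, hTt, hbig, hover⟩ :=
    hU.exists_overfull_levels (by omega) hn hc hmul (hU'.weight N le_rfl)
      (fun v hv => hU'.le_lowWeight (by omega) hv)
      (fun m => (hJ m).symm ▸ Finset.card_le_card
        (Finset.filter_subset_filter _ (hU'.subset_last (by omega)))) hm hm'
  exact hU.not_overfull_levels hp (fun i => hc i ▸ Nat.mod_lt _ hn) hmul htu hun hk hz hzm hzu hT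
    hTm hTt hbig hover

/-- All minimal chains use the same number of tokens of each exponent in each cut. -/
theorem IsMinTokenChain.card_filter_eq {J' : Finset ι} {U' : ℕ → Finset ι}
    (hU : IsMinTokenChain p (p ^ n) c e N J U) (hU' : IsMinTokenChain p (p ^ n) c e N J' U')
    (hp : 2 ≤ p) (hn : 0 < n) (hc : ∀ i, c i = e i % n)
    (hmul : ∀ m, (J.filter fun i => e i = m).card < p)
    (hJ : ∀ m, (J.filter fun i => e i = m).card = (J'.filter fun i => e i = m).card)
    {k : ℕ} (hk : k ≤ N + 1) (m : ℕ) :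
    ((U k).filter fun i => e i = m).card = ((U' k).filter fun i => e i = m).card := by
  induction N generalizing J J' k m with
  | zero =>
    rcases Nat.le_one_iff_eq_zero_or_eq_one.mp hk with rfl | rfl
    · rw [hU.zero, hU'.zero]
    · have h1 := hU.last
      have h2 := hU'.last
      rw [zero_add] at h1 h2
      rw [h1, h2, hJ]
  | succ N ih =>
    have htop : ∀ m, ((U (N + 1)).filter fun i => e i = m).card
        = ((U' (N + 1)).filter fun i => e i = m).card := by
      by_contra! hcon
      let D := ((U (N + 1) ∪ U' (N + 1)).image e).filter fun m =>
        ((U (N + 1)).filter fun i => e i = m).card ≠ ((U' (N + 1)).filter fun i => e i = m).card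
      have hD : ∀ m, ((U (N + 1)).filter fun i => e i = m).card
          ≠ ((U' (N + 1)).filter fun i => e i = m).card → m ∈ D := by
        intro m hm
        refine Finset.mem_filter.mpr ⟨?_, hm⟩
        by_contra hnot
        refine hm ?_
        rw [Finset.filter_false_of_mem, Finset.filter_false_of_mem]
        · rintro i hi rfl
          exact hnot (Finset.mem_image_of_mem e (Finset.mem_union_right _ hi))
        · rintro i hi rfl
          exact hnot (Finset.mem_image_of_mem e (Finset.mem_union_left _ hi))
      obtain ⟨m₀, hm₀⟩ := hcon
      obtain ⟨m, hm, hmax⟩ := D.exists_max_image id ⟨m₀, hD m₀ hm₀⟩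
      have hgt : ∀ m' > m, ((U (N + 1)).filter fun i => e i = m').card
          = ((U' (N + 1)).filter fun i => e i = m').card := by
        intro m' hm'
        by_contra h
        exact absurd (hmax m' (hD m' h)) (not_le.mpr hm')
      rcases lt_or_gt_of_ne (Finset.mem_filter.mp hm).2 with h | h
      · exact hU'.not_card_lt hU.toIsTokenChain hp hn hc (fun m => hJ m ▸ hmul m)
          (fun m => (hJ m).symm) hgt h
      · exact hU.not_card_lt hU'.toIsTokenChain hp hn hc hmul hJ
          (fun m' hm' => (hgt m' hm').symm) h
    rcases hk.eq_or_lt with rfl | hk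
    · rw [hU.last, hU'.last, hJ]
    · refine ih hU.truncate hU'.truncate (fun m => lt_of_le_of_lt ?_ (hmul m)) htop (by omega) m
      exact Finset.card_le_card (Finset.filter_subset_filter _ (hU.subset_last (by omega)))

omit [DecidableEq ι] in
lemma sum_range_mul_sub_one_mul_pow (hp : 0 < p) (a v : ℕ) :
    ∑ s ∈ Finset.range v, a * (p - 1) * p ^ s = a * (p ^ v - 1) := by
  obtain ⟨p, rfl⟩ : ∃ r, p = r + 1 := ⟨p - 1, by omega⟩
  rw [← Finset.mul_sum, mul_assoc, Nat.add_sub_cancel]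
  congr 1
  induction v with
  | zero => simp
  | succ v ih =>
    rw [Finset.sum_range_succ, mul_add, ih, pow_succ]
    have := Nat.pow_pos (n := v) hp
    rw [mul_add, mul_one, mul_comm p]
    omega

omit [DecidableEq ι] in
/-- Chains exist when all low weights are large enough. -/
lemma exists_isTokenChain (hp : 0 < p)
    (h : ∀ v < n, N * (p ^ (v + 1) - 1) ≤ lowWeight p c v J) :
    ∃ U, IsTokenChain p (p ^ n) c N J U := by
  induction N generalizing J with
  | zero =>
    refine ⟨fun k => if k = 0 then ∅ else J, rfl, ?_, rfl, ?_⟩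
    · intro k hk
      obtain rfl : k = 0 := by omega
      simp
    · intro k hk
      obtain rfl : k = 0 := by omega
      simp
  | succ N ih =>
    have hsum : ∀ v ≤ n, ∑ s ∈ Finset.range v, (if s < n then (N + 1) * (p - 1) * p ^ s else 0)
        = (N + 1) * (p ^ v - 1) := by
      intro v hv
      rw [← sum_range_mul_sub_one_mul_pow hp]
      refine Finset.sum_congr rfl fun s hs => if_pos ?_
      have := Finset.mem_range.mp hs
      omega
    obtain ⟨A, hA, -, hAw, hAl⟩ := exists_subset_partial_weight (p := p) (c := c) J
      (fun s => if s < n then (N + 1) * (p - 1) * p ^ s else 0)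
      (fun v => by
        split_ifs
        · exact dvd_mul_left _ _
        · exact dvd_zero _)
      (fun v hv => by
        have hvn : v < n := by
          by_contra hvn
          exact hv (if_neg hvn)
        rw [hsum _ hvn]
        exact h v hvn) n
    obtain ⟨U, hU⟩ := ih (J := A) fun v hv => by
      have h1 := hAl v hv
      rw [hsum _ hv] at h1
      exact (Nat.mul_le_mul_right _ (Nat.le_succ N)).trans h1
    rw [hsum n le_rfl] at hAw
    let V : ℕ → Finset ι := fun l => if l ≤ N + 1 then U l else J
    have h1 : ∀ l ≤ N + 1, V l = U l := fun l hl => if_pos hl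
    have h2 : V (N + 1 + 1) = J := if_neg (by omega)
    refine ⟨V, by rw [h1 0 (by omega), hU.zero], fun k hk => ?_, h2, fun k hk => ?_⟩
    · rw [h1 k hk]
      rcases hk.eq_or_lt with rfl | hk
      · rw [h2, hU.last]
        exact hA
      · rw [h1 (k + 1) hk]
        exact hU.mono k (by omega)
    · rw [h1 k hk]
      rcases hk.eq_or_lt with rfl | hk
      · rw [hU.last, hAw]
      · exact hU.weight k (by omega)

omit [DecidableEq ι] in
lemma IsTokenChain.exists_isMinTokenChain (e : ι → ℕ) (hU : IsTokenChain p q c N J U) :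
    ∃ V, IsMinTokenChain p q c e N J V := by
  classical
  have h : ∃ a, ∃ V, IsTokenChain p q c N J V ∧ chainCost p e N V = a := ⟨_, U, hU, rfl⟩
  obtain ⟨V, hV, hVa⟩ := Nat.find_spec h
  exact ⟨V, hV, fun W hW => hVa.trans_le (Nat.find_min' h ⟨W, hW, rfl⟩)⟩

omit [DecidableEq ι] in
/-- If cyclically shifting the classes does not lower the total weight, all low weights are
large. -/
lemma le_lowWeight_univ [Fintype ι] (hp : 2 ≤ p) (hn : 0 < n)
    (hmin : ∀ s, ∑ i, p ^ (e i % n) ≤ ∑ i, p ^ ((e i + s) % n))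
    (hN : N * (p ^ n - 1) ≤ ∑ i, p ^ (e i % n)) {v : ℕ} (hv : v < n) :
    N * (p ^ (v + 1) - 1) ≤ lowWeight p (fun i => e i % n) v Finset.univ := by
  have h1 := hmin (n - 1 - v)
  have h2 : p ^ (v + 1) * ∑ i, p ^ ((e i + (n - 1 - v)) % n)
      = p ^ n * lowWeight p (fun i => e i % n) v Finset.univ
        + ∑ i with ¬ e i % n ≤ v, p ^ (e i % n) := by
    rw [Finset.mul_sum, lowWeight, Finset.mul_sum,
      ← Finset.sum_filter_add_sum_filter_not Finset.univ fun i => e i % n ≤ v]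
    congr 1
    · refine Finset.sum_congr rfl fun i hi => ?_
      have hi := (Finset.mem_filter.mp hi).2
      rw [Nat.add_mod, Nat.mod_eq_of_lt (a := n - 1 - v) (by omega), Nat.mod_eq_of_lt (by omega),
        ← pow_add, ← pow_add]
      congr 1
      omega
    · refine Finset.sum_congr rfl fun i hi => ?_
      have hi := (Finset.mem_filter.mp hi).2
      have := Nat.mod_lt (e i) hn
      rw [Nat.add_mod, Nat.mod_eq_of_lt (a := n - 1 - v) (by omega),
        Nat.mod_eq_sub_mod (by omega), Nat.mod_eq_of_lt (by omega), ← pow_add]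
      congr 1
      omega
  have h3 := Finset.sum_filter_add_sum_filter_not Finset.univ (fun i => e i % n ≤ v)
    (fun i => p ^ (e i % n))
  rw [lowWeight] at h2 ⊢
  generalize ∑ i with e i % n ≤ v, p ^ (e i % n) = a at *
  generalize ∑ i with ¬ e i % n ≤ v, p ^ (e i % n) = b at *
  generalize ∑ i, p ^ (e i % n) = W at *
  have h4 := Nat.mul_le_mul_left (p ^ (v + 1)) h1
  rw [h2] at h4
  have hq : 1 < p ^ n := Nat.one_lt_pow hn.ne' (by omega)
  obtain ⟨Q, hQ⟩ : ∃ Q, p ^ n = Q + 2 := ⟨p ^ n - 2, by omega⟩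
  obtain ⟨R, hR⟩ : ∃ R, p ^ (v + 1) = R + 1 := ⟨p ^ (v + 1) - 1, by
    have := Nat.pow_pos (n := v + 1) (show 0 < p by omega); omega⟩
  rw [hQ] at h4 hN
  rw [hR] at h4 ⊢
  rw [Nat.add_sub_cancel]
  rw [show Q + 2 - 1 = Q + 1 by omega] at hN
  by_contra! hlt
  nlinarith

end TokenChains

section PowerSums

variable {F : Type*} [Field F] [Fintype F]

lemma sum_pow_eq_ite (V : ℕ) :
    ∑ x : F, x ^ V = if 0 < V ∧ Fintype.card F - 1 ∣ V then -1 else 0 := by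
  classical
  rcases Nat.eq_zero_or_pos V with rfl | hV
  · simp
  · rw [← Fintype.sum_subtype_add_sum_subtype (fun x : F => x ≠ 0)]
    have h1 : ∑ x : {x : F // ¬ x ≠ 0}, (x : F) ^ V = 0 := by
      refine Finset.sum_eq_zero fun x _ => ?_
      rw [not_not.mp x.2, zero_pow hV.ne']
    have h2 : ∑ x : {x : F // x ≠ 0}, (x : F) ^ V = ∑ x : Fˣ, (x : F) ^ V :=
      (Fintype.sum_equiv unitsEquivNeZero _ _ fun x => rfl).symm
    rw [h1, h2, FiniteField.sum_pow_units, add_zero]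
    simp [hV]

/-- A sum over the monic polynomials of degree `N`, parametrized by their coefficients. -/
lemma sum_monic_eq_sum_coeffs {A : Type*} [AddCommMonoid A] {M : Finset F[X]} {N : ℕ}
    (hM : ∀ f, f ∈ M ↔ f.Monic ∧ f.natDegree = N) (G : F[X] → A) :
    ∑ f ∈ M, G f = ∑ a : Fin N → F,
      G (∑ k : Fin (N + 1), C (Fin.snoc (α := fun _ => F) a 1 k) * X ^ (k : ℕ)) := by
  have hform : ∀ a : Fin N → F, ∑ k : Fin (N + 1), C (Fin.snoc (α := fun _ => F) a 1 k)
      * X ^ (k : ℕ) = X ^ N + ∑ k : Fin N, C (a k) * X ^ (k : ℕ) := by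
    intro a
    rw [Fin.sum_univ_castSucc]
    simp [add_comm]
  have hdeg : ∀ a : Fin N → F, (∑ k : Fin N, C (a k) * X ^ (k : ℕ)).degree < (N : WithBot ℕ) :=
    fun a => degree_sum_fin_lt a
  symm
  refine Finset.sum_bij' (fun a _ => ∑ k : Fin (N + 1), C (Fin.snoc (α := fun _ => F) a 1 k)
      * X ^ (k : ℕ)) (fun f _ k => f.coeff k) ?_ (fun _ _ => Finset.mem_univ _) ?_ ?_
      (fun _ _ => rfl)
  · intro a _
    rw [hM, hform]
    refine ⟨monic_X_pow_add (hdeg a), natDegree_eq_of_degree_eq_some ?_⟩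
    rw [degree_add_eq_left_of_degree_lt (by rw [degree_X_pow]; exact hdeg a), degree_X_pow]
  · intro a _
    funext k
    rw [hform]
    simp only [coeff_add, coeff_X_pow, finsetSum_coeff, coeff_C_mul]
    rw [if_neg (by have := k.2; omega), zero_add, Finset.sum_eq_single k]
    · simp
    · intro b _ hb
      rw [if_neg (fun h => hb (Fin.ext h.symm)), mul_zero]
    · simp
  · intro f hf
    obtain ⟨h1, h2⟩ := (hM f).mp hf
    rw [hform]
    conv_rhs => rw [h1.as_sum, h2, Finset.sum_range]

/-- Expansion of a power sum over monic polynomials of degree `N`, for the exponent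
`∑ i, p ^ e i`. -/
theorem sum_monic_pow_eq {p : ℕ} [Fact p.Prime] [CharP F p] {M : Finset F[X]} {N : ℕ}
    (hM : ∀ f, f ∈ M ↔ f.Monic ∧ f.natDegree = N) {ι : Type*} [Fintype ι] [DecidableEq ι]
    (e : ι → ℕ) :
    ∑ f ∈ M, f ^ (∑ i, p ^ e i) = ∑ κ : ι → Fin (N + 1),
      C (∏ k : Fin N, ∑ x : F, x ^ (∑ i with κ i = k.castSucc, p ^ e i))
        * X ^ (∑ i, (κ i : ℕ) * p ^ e i) := by
  rw [sum_monic_eq_sum_coeffs hM fun f => f ^ (∑ i, p ^ e i)]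
  have hexp : ∀ a : Fin N → F, (∑ k : Fin (N + 1), C (Fin.snoc (α := fun _ => F) a 1 k)
      * X ^ (k : ℕ)) ^ (∑ i, p ^ e i) = ∑ κ : ι → Fin (N + 1),
        C (∏ k : Fin N, a k ^ (∑ i with κ i = k.castSucc, p ^ e i))
          * X ^ (∑ i, (κ i : ℕ) * p ^ e i) := by
    intro a
    rw [← Finset.prod_pow_eq_pow_sum]
    simp_rw [sum_pow_char_pow]
    rw [Fintype.prod_sum]
    refine Finset.sum_congr rfl fun κ _ => ?_
    simp_rw [mul_pow, ← C_pow, ← pow_mul]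
    rw [Finset.prod_mul_distrib, Finset.prod_pow_eq_pow_sum, ← map_prod]
    congr 2
    rw [← Finset.prod_fiberwise Finset.univ κ, Fin.prod_univ_castSucc]
    have h1 : ∏ i with κ i = Fin.last N, (Fin.snoc (α := fun _ => F) a 1 (κ i)) ^ p ^ e i
        = 1 := by
      refine Finset.prod_eq_one fun i hi => ?_
      rw [(Finset.mem_filter.mp hi).2, Fin.snoc_last, one_pow]
    rw [h1, mul_one]
    refine Finset.prod_congr rfl fun k _ => ?_
    rw [← Finset.prod_pow_eq_pow_sum]
    refine Finset.prod_congr rfl fun i hi => ?_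
    rw [(Finset.mem_filter.mp hi).2, Fin.snoc_castSucc]
  simp_rw [hexp]
  rw [Finset.sum_comm]
  refine Finset.sum_congr rfl fun κ _ => ?_
  rw [← Finset.sum_mul, ← map_sum, Fintype.prod_sum]

end PowerSums

section CountingOrbits

lemma exists_perm_of_card_filter_eq {ι β : Type*} [Fintype ι] [DecidableEq β] {e : ι → ℕ}
    {κ κ₀ : ι → β} (h : ∀ m k, (Finset.univ.filter fun i => e i = m ∧ κ i = k).card
      = (Finset.univ.filter fun i => e i = m ∧ κ₀ i = k).card) :
    ∃ σ : Equiv.Perm ι, ∀ i, e (σ i) = e i ∧ κ₀ (σ i) = κ i := by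
  have hfib : ∀ x : ℕ × β, Nonempty ({i // (e i, κ i) = x} ≃ {i // (e i, κ₀ i) = x}) := by
    rintro ⟨m, k⟩
    refine Fintype.card_eq.mp ?_
    simp only [Fintype.card_subtype, Prod.mk.injEq]
    exact h m k
  refine ⟨Equiv.ofFiberEquiv (f := fun i => (e i, κ i))
    (g := fun i => (e i, κ₀ i)) fun x => (hfib x).some, fun i => Prod.mk.inj ?_⟩
  exact Equiv.ofFiberEquiv_map (f := fun i => (e i, κ i)) (g := fun i => (e i, κ₀ i)) _ i

/-- Functions with the same joint counts with `e` as `κ₀` form an orbit of the group of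
permutations preserving `e`, whose order is prime to `p` if the fibres of `e` are small. -/
theorem not_dvd_card_of_card_filter_eq {ι β : Type*} [Fintype ι] [DecidableEq ι] [DecidableEq β]
    {p : ℕ} (hp : p.Prime) (e : ι → ℕ)
    (hmul : ∀ m, (Finset.univ.filter fun i => e i = m).card < p) (κ₀ : ι → β)
    (Ω : Finset (ι → β))
    (hΩ : ∀ κ, κ ∈ Ω ↔ ∀ m k, (Finset.univ.filter fun i => e i = m ∧ κ i = k).card
      = (Finset.univ.filter fun i => e i = m ∧ κ₀ i = k).card) : ¬ p ∣ Ω.card := by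
  classical
  let H := MulAction.stabilizer (Equiv.Perm ι)ᵈᵐᵃ e
  have hmem : ∀ σ : Equiv.Perm ι, DomMulAct.mk σ ∈ H ↔ e ∘ σ = e := fun σ => Iff.rfl
  have hcard : Nat.card H = ∏ m ∈ Finset.univ.image e, (Fintype.card {i // e i = m}).factorial := by
    rw [← DomMulAct.stabilizer_card' e, ← Nat.card_eq_fintype_card]
    exact (Nat.card_congr (Equiv.subtypeEquiv DomMulAct.mk fun _ => Iff.rfl)).symm
  have hH : ¬ p ∣ Nat.card H := by
    rw [hcard, hp.prime.dvd_finsetProd_iff]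
    rintro ⟨m, -, hm⟩
    rw [hp.dvd_factorial, Fintype.card_subtype] at hm
    exact absurd (hmul m) (not_lt.mpr hm)
  have horb : (Ω : Set (ι → β)) = MulAction.orbit H κ₀ := by
    ext κ
    rw [Finset.mem_coe, hΩ]
    constructor
    · intro h
      obtain ⟨σ, hσ⟩ := exists_perm_of_card_filter_eq h
      exact ⟨⟨DomMulAct.mk σ, (hmem σ).mpr (funext fun i => (hσ i).1)⟩,
        funext fun i => (hσ i).2⟩
    · rintro ⟨⟨g, hg⟩, rfl⟩ m k
      obtain ⟨σ, rfl⟩ := DomMulAct.mk.surjective g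
      rw [hmem] at hg
      refine Finset.card_bij (fun i _ => σ i) ?_ (fun _ _ _ _ h => σ.injective h) ?_
      · intro i hi
        simp only [Finset.mem_filter, Finset.mem_univ, true_and] at hi ⊢
        exact ⟨(congrFun hg i).trans hi.1, hi.2⟩
      · intro i hi
        simp only [Finset.mem_filter, Finset.mem_univ, true_and] at hi
        refine ⟨σ.symm i, ?_, by simp⟩
        simp only [Finset.mem_filter, Finset.mem_univ, true_and]
        have h1 := congrFun hg (σ.symm i)
        simp only [Function.comp_apply, Equiv.apply_symm_apply] at h1
        refine ⟨h1 ▸ hi.1, ?_⟩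
        change κ₀ (σ (σ.symm i)) = k
        rw [Equiv.apply_symm_apply]
        exact hi.2
  intro hdvd
  refine hH (hdvd.trans ?_)
  have h1 : Ω.card = Nat.card (MulAction.orbit H κ₀) := by
    rw [← horb]; simp
  rw [h1, Nat.card_congr (MulAction.orbitEquivQuotientStabilizer H κ₀)]
  exact Subgroup.card_quotient_dvd_card _

end CountingOrbits

section Nonvanishing

variable {ι : Type*} [Fintype ι] [DecidableEq ι] {p n N : ℕ} {e : ι → ℕ}

lemma pow_modEq_pow_mod (hp : 0 < p) (a : ℕ) : p ^ a ≡ p ^ (a % n) [MOD p ^ n - 1] := by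
  have h1 : p ^ n ≡ 1 [MOD p ^ n - 1] :=
    ((Nat.modEq_iff_dvd' (Nat.pow_pos hp)).mpr dvd_rfl).symm
  conv_lhs => rw [← Nat.div_add_mod a n, pow_add, pow_mul]
  simpa using (h1.pow (a / n)).mul_right (p ^ (a % n))

omit [Fintype ι] in
lemma sum_pow_modEq (hp : 0 < p) (S : Finset ι) :
    ∑ i ∈ S, p ^ e i ≡ ∑ i ∈ S, p ^ (e i % n) [MOD p ^ n - 1] := by
  induction S using Finset.induction_on with
  | empty => rfl
  | insert i S hi ih =>
    rw [Finset.sum_insert hi, Finset.sum_insert hi]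
    exact (pow_modEq_pow_mod hp (e i)).add ih

/-- A distribution of tokens into bins all of whose bins, except possibly the last one, have a
positive value divisible by `q - 1`. -/
def IsValidDistribution (p q : ℕ) (e : ι → ℕ) (κ : ι → Fin (N + 1)) : Prop :=
  ∀ k : Fin N, 0 < ∑ i with κ i = k.castSucc, p ^ e i ∧
    q - 1 ∣ ∑ i with κ i = k.castSucc, p ^ e i

lemma IsValidDistribution.dvd_weight {κ : ι → Fin (N + 1)} (hp : 0 < p)
    (h : IsValidDistribution p (p ^ n) e κ) (k : Fin N) :
    p ^ n - 1 ∣ ∑ i with κ i = k.castSucc, p ^ (e i % n) :=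
  ((sum_pow_modEq hp _).dvd_iff dvd_rfl).mp (h k).2

lemma IsValidDistribution.le_weight {κ : ι → Fin (N + 1)} (hp : 0 < p)
    (h : IsValidDistribution p (p ^ n) e κ) (k : Fin N) :
    p ^ n - 1 ≤ ∑ i with κ i = k.castSucc, p ^ (e i % n) := by
  refine Nat.le_of_dvd ?_ (h.dvd_weight hp k)
  obtain ⟨i, hi, -⟩ := Finset.exists_ne_zero_of_sum_ne_zero (h k).1.ne'
  exact Finset.sum_pos (fun i _ => Nat.pow_pos hp) ⟨i, hi⟩

omit [DecidableEq ι] in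
lemma sum_bins_add_last (κ : ι → Fin (N + 1)) (g : ι → ℕ) :
    ∑ k : Fin N, ∑ i with κ i = k.castSucc, g i + ∑ i with κ i = Fin.last N, g i = ∑ i, g i := by
  rw [← Finset.sum_fiberwise Finset.univ κ, Fin.sum_univ_castSucc]

lemma IsValidDistribution.mul_le {κ : ι → Fin (N + 1)} (hp : 0 < p)
    (h : IsValidDistribution p (p ^ n) e κ) : N * (p ^ n - 1) ≤ ∑ i, p ^ (e i % n) := by
  rw [← sum_bins_add_last κ]
  refine le_trans ?_ (Nat.le_add_right _ _)
  simpa using Finset.card_nsmul_le_sum Finset.univ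
    (fun k : Fin N => ∑ i with κ i = k.castSucc, p ^ (e i % n)) _ fun k _ => h.le_weight hp k

lemma IsValidDistribution.weight_eq {κ : ι → Fin (N + 1)} (hp : 0 < p)
    (h : IsValidDistribution p (p ^ n) e κ)
    (hW : ∑ i, p ^ (e i % n) < (N + 1) * (p ^ n - 1)) (k : Fin N) :
    ∑ i with κ i = k.castSucc, p ^ (e i % n) = p ^ n - 1 := by
  by_contra hne
  obtain ⟨a, ha⟩ := h.dvd_weight hp k
  have hle := h.le_weight hp k
  have ha2 : 2 ≤ a := by
    by_contra! hlt
    interval_cases a <;> omega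
  have h1 := Nat.mul_le_mul_left (p ^ n - 1) ha2
  have h2 := sum_bins_add_last κ fun i => p ^ (e i % n)
  rw [← Finset.add_sum_erase _ _ (Finset.mem_univ k)] at h2
  have h3 := Finset.card_nsmul_le_sum (Finset.univ.erase k)
    (fun k : Fin N => ∑ i with κ i = k.castSucc, p ^ (e i % n)) _ fun k _ => h.le_weight hp k
  have hN : 0 < N := k.pos
  rw [Finset.card_erase_of_mem (Finset.mem_univ k), Finset.card_univ, Fintype.card_fin,
    smul_eq_mul] at h3
  obtain ⟨N', rfl⟩ : ∃ N', N = N' + 1 := ⟨N - 1, by omega⟩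
  rw [Nat.add_sub_cancel] at h3
  have h4 : (N' + 1 + 1) * (p ^ n - 1) = N' * (p ^ n - 1) + (p ^ n - 1) * 2 := by ring
  omega

omit [DecidableEq ι] in
lemma sum_lt_succ (κ : ι → Fin (N + 1)) (g : ι → ℕ) (k : ℕ) (hk : k < N + 1) :
    ∑ i with (κ i : ℕ) < k + 1, g i
      = ∑ i with (κ i : ℕ) < k, g i + ∑ i with κ i = ⟨k, hk⟩, g i := by
  classical
  rw [← Finset.sum_union]
  · refine Finset.sum_congr ?_ fun _ _ => rfl
    ext i
    simp only [Finset.mem_filter, Finset.mem_univ, true_and, Finset.mem_union, Fin.ext_iff]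
    omega
  · rw [Finset.disjoint_filter]
    rintro i - h1 h2
    rw [h2] at h1
    exact lt_irrefl _ h1

lemma IsValidDistribution.isTokenChain {κ : ι → Fin (N + 1)} (hp : 0 < p)
    (h : IsValidDistribution p (p ^ n) e κ)
    (hW : ∑ i, p ^ (e i % n) < (N + 1) * (p ^ n - 1)) :
    IsTokenChain p (p ^ n) (fun i => e i % n) N Finset.univ
      fun k => Finset.univ.filter fun i => (κ i : ℕ) < k := by
  refine ⟨by simp, fun k _ => Finset.monotone_filter_right _ fun i _ hi => ?_, ?_, fun k hk => ?_⟩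
  · exact Nat.lt_succ_of_lt hi
  · exact Finset.filter_true_of_mem fun i _ => (κ i).2
  · induction k with
    | zero => simp
    | succ k ih =>
      rw [sum_lt_succ κ _ k (by omega), ih (by omega), add_mul, one_mul]
      congr 1
      exact h.weight_eq hp hW ⟨k, hk⟩

lemma isValidDistribution_of_isTokenChain {κ : ι → Fin (N + 1)} (hp : 2 ≤ p) (hn : 0 < n)
    (h : IsTokenChain p (p ^ n) (fun i => e i % n) N Finset.univ
      fun k => Finset.univ.filter fun i => (κ i : ℕ) < k) :
    IsValidDistribution p (p ^ n) e κ := by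
  intro k
  have h1 := sum_lt_succ κ (fun i => p ^ (e i % n)) k (by omega)
  have h2 := h.weight k k.2.le
  have h3 := h.weight (k + 1) k.2
  rw [h2, h3, add_mul, one_mul] at h1
  have h4 : ∑ i with κ i = k.castSucc, p ^ (e i % n) = p ^ n - 1 := (Nat.add_left_cancel h1).symm
  have hq : 1 < p ^ n := Nat.one_lt_pow hn.ne' (by omega)
  constructor
  · have hne : ∑ i with κ i = k.castSucc, p ^ (e i % n) ≠ 0 := by omega
    obtain ⟨i, hi, -⟩ := Finset.exists_ne_zero_of_sum_ne_zero hne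
    exact Finset.sum_pos (fun i _ => Nat.pow_pos (by omega)) ⟨i, hi⟩
  · rw [(sum_pow_modEq (n := n) (by omega) _).dvd_iff dvd_rfl, h4]

omit [DecidableEq ι] in
lemma IsTokenChain.exists_distribution {q : ℕ} {c : ι → ℕ} {U : ℕ → Finset ι}
    (h : IsTokenChain p q c N Finset.univ U) :
    ∃ κ : ι → Fin (N + 1), ∀ k ≤ N + 1, U k = Finset.univ.filter fun i => (κ i : ℕ) < k := by
  classical
  have hex : ∀ i, ∃ k, i ∈ U (k + 1) := fun i => ⟨N, by rw [h.last]; exact Finset.mem_univ i⟩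
  refine ⟨fun i => ⟨Nat.find (hex i), Nat.lt_succ_of_le (Nat.find_min' (hex i) (by
    rw [h.last]; exact Finset.mem_univ i))⟩, fun k hk => ?_⟩
  ext i
  simp only [Finset.mem_filter, Finset.mem_univ, true_and]
  constructor
  · intro hi
    rcases k with _ | k
    · rw [h.zero] at hi
      simp at hi
    · exact Nat.lt_succ_of_le (Nat.find_min' (hex i) hi)
  · intro hi
    exact h.subset_of_le hi hk (Nat.find_spec (hex i))

omit [DecidableEq ι] in
lemma sum_mul_add_chainCost (κ : ι → Fin (N + 1)) :
    ∑ i, (κ i : ℕ) * p ^ e i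
      + chainCost p e N (fun k => Finset.univ.filter fun i => (κ i : ℕ) < k)
      = N * ∑ i, p ^ e i := by
  rw [chainCost]
  simp_rw [Finset.sum_filter]
  rw [Finset.sum_comm, ← Finset.sum_add_distrib, Finset.mul_sum]
  refine Finset.sum_congr rfl fun i _ => ?_
  rw [← Finset.sum_filter, Finset.sum_const, smul_eq_mul, ← add_mul]
  congr 1
  have : (Finset.range (N + 1)).filter (fun k => (κ i : ℕ) < k) = Finset.Ioc (κ i : ℕ) N := by
    ext k
    simp only [Finset.mem_filter, Finset.mem_range, Finset.mem_Ioc]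
    omega
  rw [this, Nat.card_Ioc]
  have := (κ i).2
  omega

variable {F : Type*} [Field F] [Fintype F]

omit [DecidableEq ι] in
lemma prod_sum_pow_eq_ite (hq : Fintype.card F = p ^ n) (κ : ι → Fin (N + 1))
    [Decidable (IsValidDistribution p (p ^ n) e κ)] :
    ∏ k : Fin N, ∑ x : F, x ^ (∑ i with κ i = k.castSucc, p ^ e i)
      = if IsValidDistribution p (p ^ n) e κ then (-1) ^ N else 0 := by
  classical
  simp_rw [sum_pow_eq_ite, hq]
  rw [Finset.prod_ite_zero, Finset.prod_const, Finset.card_univ, Fintype.card_fin]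
  congr 1
  simp [IsValidDistribution]

/-- If the power sum does not vanish, then the weight of the tokens is large. -/
lemma mul_le_of_sum_monic_pow_ne_zero [Fact p.Prime] [CharP F p] (hq : Fintype.card F = p ^ n)
    {M : Finset F[X]} (hM : ∀ f, f ∈ M ↔ f.Monic ∧ f.natDegree = N)
    (h : ∑ f ∈ M, f ^ (∑ i, p ^ e i) ≠ 0) : N * (p ^ n - 1) ≤ ∑ i, p ^ (e i % n) := by
  classical
  rw [sum_monic_pow_eq hM e] at h
  obtain ⟨κ, -, hκ⟩ := Finset.exists_ne_zero_of_sum_ne_zero h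
  rw [prod_sum_pow_eq_ite hq] at hκ
  by_cases hv : IsValidDistribution p (p ^ n) e κ
  · exact hv.mul_le (Fact.out : p.Prime).pos
  · simp [hv] at hκ

/-- The power sum does not vanish in the extremal degree, provided that the total weight is minimal
among its cyclic shifts. -/
theorem sum_monic_pow_ne_zero [Fact p.Prime] [CharP F p] (hn : 0 < n)
    (hq : Fintype.card F = p ^ n) {M : Finset F[X]}
    (hM : ∀ f, f ∈ M ↔ f.Monic ∧ f.natDegree = N)
    (hmul : ∀ m, (Finset.univ.filter fun i => e i = m).card < p)
    (hmin : ∀ s, ∑ i, p ^ (e i % n) ≤ ∑ i, p ^ ((e i + s) % n))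
    (hN : N * (p ^ n - 1) ≤ ∑ i, p ^ (e i % n))
    (hN' : ∑ i, p ^ (e i % n) < (N + 1) * (p ^ n - 1)) :
    ∑ f ∈ M, f ^ (∑ i, p ^ e i) ≠ 0 := by
  classical
  have hpr : p.Prime := Fact.out
  obtain ⟨U₁, hU₁⟩ := exists_isTokenChain (c := fun i => e i % n) (J := Finset.univ) hpr.pos
    fun v hv => le_lowWeight_univ hpr.two_le hn hmin hN hv
  obtain ⟨U₀, hU₀⟩ := hU₁.exists_isMinTokenChain e
  obtain ⟨κ₀, hκ₀⟩ := hU₀.exists_distribution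
  let Ch : (ι → Fin (N + 1)) → ℕ → Finset ι := fun κ k => Finset.univ.filter fun i => (κ i : ℕ) < k
  have hcost₀ : chainCost p e N U₀ = chainCost p e N (Ch κ₀) :=
    Finset.sum_congr rfl fun k hk => by rw [hκ₀ k (Finset.mem_range.mp hk).le]
  have hCh : ∀ k ≤ N + 1, Ch κ₀ k = U₀ k := fun k hk => (hκ₀ k hk).symm
  have hCh₀ : IsTokenChain p (p ^ n) (fun i => e i % n) N Finset.univ (Ch κ₀) := by
    refine ⟨by simp [Ch], fun k hk => ?_, ?_, fun k hk => ?_⟩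
    · rw [hCh k (by omega), hCh (k + 1) (by omega)]
      exact hU₀.mono k hk
    · rw [hCh (N + 1) le_rfl]
      exact hU₀.last
    · rw [hCh k (by omega)]
      exact hU₀.weight k hk
  have hmin₀ : ∀ V, IsTokenChain p (p ^ n) (fun i => e i % n) N Finset.univ V →
      chainCost p e N (Ch κ₀) ≤ chainCost p e N V := fun V hV => hcost₀ ▸ hU₀.le_cost V hV
  have hval₀ := isValidDistribution_of_isTokenChain hpr.two_le hn hCh₀
  let Ω : Finset (ι → Fin (N + 1)) := Finset.univ.filter fun κ =>
    IsValidDistribution p (p ^ n) e κ ∧ ∑ i, (κ i : ℕ) * p ^ e i = ∑ i, (κ₀ i : ℕ) * p ^ e i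
  have hΩ : ∀ κ, κ ∈ Ω ↔ ∀ m k, (Finset.univ.filter fun i => e i = m ∧ κ i = k).card
      = (Finset.univ.filter fun i => e i = m ∧ κ₀ i = k).card := by
    intro κ
    simp only [Ω, Finset.mem_filter, Finset.mem_univ, true_and]
    constructor
    · rintro ⟨hv, hd⟩ m k
      have hcost : chainCost p e N (Ch κ) = chainCost p e N (Ch κ₀) := by
        have h1 := sum_mul_add_chainCost (p := p) (e := e) κ
        have h2 := sum_mul_add_chainCost (p := p) (e := e) κ₀
        change _ + chainCost p e N (Ch κ) = _ at h1
        change _ + chainCost p e N (Ch κ₀) = _ at h2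
        omega
      have hCh := hv.isTokenChain hpr.pos hN'
      have key := fun k hk => IsMinTokenChain.card_filter_eq (U := Ch κ) (U' := Ch κ₀)
        ⟨hCh, fun V hV => hcost ▸ hmin₀ V hV⟩ ⟨hCh₀, hmin₀⟩ hpr.two_le hn (fun _ => rfl) hmul
        (fun _ => rfl) (k := k) hk m
      have h1 := key k (by omega)
      have h2 := key (k + 1) (by omega)
      have hsum : ∀ κ : ι → Fin (N + 1), ((Ch κ (k + 1)).filter fun i => e i = m).card
          = ((Ch κ k).filter fun i => e i = m).card
            + (Finset.univ.filter fun i => e i = m ∧ κ i = k).card := by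
        intro κ
        have h3 := sum_lt_succ κ (fun i => if e i = m then 1 else 0) k k.2
        simp only [← Finset.sum_filter, Finset.filter_filter, ← Finset.card_eq_sum_ones] at h3
        simp only [Ch, Finset.filter_filter, h3]
        simp only [and_comm]
      rw [hsum, hsum] at h2
      omega
    · intro h
      obtain ⟨σ, hσ⟩ := exists_perm_of_card_filter_eq h
      have hsum : ∀ g : ℕ → Fin (N + 1) → ℕ, ∑ i, g (e i) (κ i) = ∑ i, g (e i) (κ₀ i) := by
        intro g
        rw [← Equiv.sum_comp σ fun i => g (e i) (κ₀ i)]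
        exact Finset.sum_congr rfl fun i _ => by rw [(hσ i).1, (hσ i).2]
      refine ⟨fun k => ?_, hsum fun m k => k * p ^ m⟩
      have h1 := hsum fun m k' => if k' = k.castSucc then p ^ m else 0
      rw [← Finset.sum_filter, ← Finset.sum_filter] at h1
      rw [h1]
      exact hval₀ k
  have hcoeff : (∑ f ∈ M, f ^ (∑ i, p ^ e i)).coeff (∑ i, (κ₀ i : ℕ) * p ^ e i)
      = (-1) ^ N * (Ω.card : F) := by
    rw [sum_monic_pow_eq hM e, finsetSum_coeff]
    simp_rw [prod_sum_pow_eq_ite hq, coeff_C_mul, coeff_X_pow]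
    rw [Finset.cast_card, Finset.mul_sum, Finset.sum_filter]
    refine Finset.sum_congr rfl fun κ _ => ?_
    by_cases h1 : IsValidDistribution p (p ^ n) e κ <;>
      by_cases h2 : ∑ i, (κ i : ℕ) * p ^ e i = ∑ i, (κ₀ i : ℕ) * p ^ e i <;>
      simp [h1, h2, eq_comm (a := ∑ i, (κ₀ i : ℕ) * p ^ e i)]
  intro h0
  rw [h0, coeff_zero, eq_comm, mul_eq_zero, CharP.cast_eq_zero_iff F p] at hcoeff
  rcases hcoeff with h | h
  · exact absurd h (pow_ne_zero _ (neg_ne_zero.mpr one_ne_zero))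
  · exact not_dvd_card_of_card_filter_eq hpr e hmul κ₀ Ω hΩ h

end Nonvanishing

section Degree

variable {ι : Type*} [Fintype ι] [DecidableEq ι] {p n : ℕ} {e : ι → ℕ}
  {F : Type*} [Field F] [Fintype F]

omit [DecidableEq ι] [Fintype F] in
lemma sum_pow_sum_add_eq [Fact p.Prime] [CharP F p] (M : Finset F[X]) (s : ℕ) :
    ∑ f ∈ M, f ^ (∑ i, p ^ (e i + s)) = (∑ f ∈ M, f ^ (∑ i, p ^ e i)) ^ p ^ s := by
  rw [sum_pow_char_pow]
  simp_rw [← pow_mul, Finset.sum_mul, pow_add]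

omit [DecidableEq ι] in
lemma sum_pow_add_sum_mod (s t : ℕ) :
    ∑ i, p ^ ((e i + s + t) % n) = ∑ i, p ^ ((e i + (s + t)) % n) := by
  simp_rw [add_assoc]

/-- The largest degree in which the power sum does not vanish, in terms of the weights of the
cyclic shifts of the tokens. -/
theorem isGreatest_setOf_sum_monic_pow_ne_zero [Fact p.Prime] [CharP F p] (hn : 0 < n)
    (hq : Fintype.card F = p ^ n) {M : ℕ → Finset F[X]}
    (hM : ∀ d f, f ∈ M d ↔ f.Monic ∧ f.natDegree = d)
    (hmul : ∀ m, (Finset.univ.filter fun i => e i = m).card < p) {s : ℕ}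
    (hs : ∀ t, ∑ i, p ^ ((e i + s) % n) ≤ ∑ i, p ^ ((e i + t) % n)) :
    IsGreatest {d | ∑ f ∈ M d, f ^ (∑ i, p ^ e i) ≠ 0}
      ((∑ i, p ^ ((e i + s) % n)) / (p ^ n - 1)) := by
  have hpr : p.Prime := Fact.out
  have hq1 : 0 < p ^ n - 1 := Nat.sub_pos_of_lt (Nat.one_lt_pow hn.ne' hpr.one_lt)
  have hshift : ∀ d, ∑ f ∈ M d, f ^ (∑ i, p ^ e i) ≠ 0 ↔
      ∑ f ∈ M d, f ^ (∑ i, p ^ (e i + s)) ≠ 0 := fun d => by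
    rw [sum_pow_sum_add_eq, Ne, Ne, pow_eq_zero_iff (pow_ne_zero _ hpr.ne_zero)]
  constructor
  · rw [Set.mem_ofPred_eq, hshift]
    refine sum_monic_pow_ne_zero (e := fun i => e i + s) hn hq (hM _) (fun m => ?_)
      (fun t => ?_) (Nat.div_mul_le_self _ _) ?_
    · refine lt_of_le_of_lt (Finset.card_le_card fun i hi => ?_) (hmul (m - s))
      simp only [Finset.mem_filter, Finset.mem_univ, true_and] at hi ⊢
      omega
    · rw [sum_pow_add_sum_mod]
      exact hs _
    · rw [mul_comm]
      exact Nat.lt_mul_div_succ _ hq1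
  · intro d hd
    rw [Set.mem_ofPred_eq, hshift] at hd
    rw [Nat.le_div_iff_mul_le hq1]
    exact mul_le_of_sum_monic_pow_ne_zero (e := fun i => e i + s) hq (hM d) hd

end Degree

section Digits

lemma sum_range_digit_mul_pow (b j k : ℕ) :
    ∑ i ∈ Finset.range k, j / b ^ i % b * b ^ i = j % b ^ k := by
  induction k with
  | zero => simp [Nat.mod_one]
  | succ k ih => rw [Finset.sum_range_succ, ih, Nat.mod_pow_succ, mul_comm]

/-- The tokens of `j`: the `p`-adic digits of its `p ^ n`-adic digits, with multiplicity. -/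
abbrev DigitToken (p n j : ℕ) : Type :=
  Σ x : Fin (j + 1) × Fin n, Fin (j / (p ^ n) ^ (x.1 : ℕ) % p ^ n / p ^ (x.2 : ℕ) % p)

variable {p n j : ℕ}

/-- The exponent of a token, once the `p ^ n`-adic digits are permuted by `π`. -/
def DigitToken.exponent (π : Equiv.Perm ℕ) (x : DigitToken p n j) : ℕ :=
  x.1.2 + n * π x.1.1

lemma DigitToken.exponent_add_mod (π : Equiv.Perm ℕ) (x : DigitToken p n j) (s : ℕ) :
    (x.exponent π + s) % n = (x.1.2 + s) % n := by
  rw [exponent, add_right_comm, Nat.add_mul_mod_self_left]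

lemma DigitToken.card_exponent_eq_lt (hp : 0 < p) (π : Equiv.Perm ℕ) (m : ℕ) :
    (Finset.univ.filter fun x : DigitToken p n j => x.exponent π = m).card < p := by
  refine lt_of_le_of_lt (b := p - 1) ?_ (by omega)
  rw [← Finset.card_range (p - 1)]
  refine Finset.card_le_card_of_injOn (fun x => (x.2 : ℕ)) (fun x _ => ?_) ?_
  · have h1 := x.2.2
    have h2 := Nat.mod_lt (j / (p ^ n) ^ (x.1.1 : ℕ) % p ^ n / p ^ (x.1.2 : ℕ)) hp
    simp only [Finset.coe_range, Set.mem_Iio]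
    omega
  · rintro ⟨⟨a, b⟩, c⟩ hx ⟨⟨a', b'⟩, c'⟩ hy hxy
    replace hx : (b : ℕ) + n * π a = m := (Finset.mem_filter.mp (Finset.mem_coe.mp hx)).2
    replace hy : (b' : ℕ) + n * π a' = m := (Finset.mem_filter.mp (Finset.mem_coe.mp hy)).2
    have hn : 0 < n := b.pos
    have hb : b = b' := Fin.ext (by
      have h1 : ((b : ℕ) + n * π a) % n = (b' + n * π a') % n := by rw [hx, hy]
      rwa [Nat.add_mul_mod_self_left, Nat.add_mul_mod_self_left, Nat.mod_eq_of_lt b.2,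
        Nat.mod_eq_of_lt b'.2] at h1)
    subst hb
    have ha : a = a' := Fin.ext (π.injective (Nat.eq_of_mul_eq_mul_left hn (by omega)))
    subst ha
    have hc : c = c' := Fin.ext hxy
    rw [hc]

lemma DigitToken.sum_pow_exponent (hp : 0 < p) (π : Equiv.Perm ℕ) :
    ∑ x : DigitToken p n j, p ^ x.exponent π = rhoStar (p ^ n) π j := by
  rw [Fintype.sum_sigma, Fintype.sum_prod_type, rhoStar, Finset.sum_range]
  refine Finset.sum_congr rfl fun a _ => ?_
  have h := sum_range_digit_mul_pow p (j / (p ^ n) ^ (a : ℕ) % p ^ n) n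
  rw [Nat.mod_eq_of_lt (Nat.mod_lt _ (Nat.pow_pos hp)), Finset.sum_range] at h
  rw [← h, Finset.sum_mul]
  refine Finset.sum_congr rfl fun b _ => ?_
  simp only [exponent, Finset.sum_const, Finset.card_univ, Fintype.card_fin, smul_eq_mul,
    pow_add, pow_mul, mul_assoc]

lemma rhoStar_one {q : ℕ} (hq : 1 < q) (j : ℕ) : rhoStar q 1 j = j := by
  simp only [rhoStar, Equiv.Perm.coe_one, id_eq]
  rw [sum_range_digit_mul_pow]
  exact Nat.mod_eq_of_lt ((Nat.lt_pow_self hq).trans (Nat.pow_lt_pow_right hq (Nat.lt_succ_self j)))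

end Digits

/-- the set `{e : S_e(j) ≠ 0}` of degrees with nonvanishing power sum
`S_e(j) = Σ_{f monic, deg f = e} f^j` is finite, contains `e = 0`, and its maximum equals
that of `{e : S_e(ρ_*(j)) ≠ 0}`; i.e., the special polynomials `z(x, −j)` and
`z(x, −ρ_*(j))` have the same degree in `x^{−1}`.  Here `M e` is the finite set of monic
polynomials of degree `e`. -/
theorem specialPolynomial_degree_invariant (p q : ℕ) (hp : p.Prime)
    (hq : ∃ n : ℕ, 0 < n ∧ q = p ^ n)
    (F : Type*) [Field F] [Fintype F] (hF : Fintype.card F = q)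
    (M : ℕ → Finset (Polynomial F))
    (hM : ∀ (e : ℕ) (f : Polynomial F), f ∈ M e ↔ f.Monic ∧ f.natDegree = e)
    (ρ : Equiv.Perm ℕ) (j : ℕ) :
    {e : ℕ | ∑ f ∈ M e, f ^ j ≠ 0}.Finite ∧
    0 ∈ {e : ℕ | ∑ f ∈ M e, f ^ j ≠ 0} ∧
    sSup {e : ℕ | ∑ f ∈ M e, f ^ j ≠ 0}
      = sSup {e : ℕ | ∑ f ∈ M e, f ^ rhoStar q ρ j ≠ 0} := by
  obtain ⟨n, hn, rfl⟩ := hq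
  have : Fact p.Prime := ⟨hp⟩
  have : CharP F p := charP_of_card_eq_prime_pow hF
  let W : ℕ → ℕ := fun s => ∑ x : DigitToken p n j, p ^ (((x.1.2 : ℕ) + s) % n)
  have hgreatest : ∀ π : Equiv.Perm ℕ,
      IsGreatest {e : ℕ | ∑ f ∈ M e, f ^ rhoStar (p ^ n) π j ≠ 0}
        (W (Function.argmin W) / (p ^ n - 1)) := by
    intro π
    have hW : ∀ s, ∑ x : DigitToken p n j, p ^ ((x.exponent π + s) % n) = W s := fun s => by
      simp_rw [DigitToken.exponent_add_mod, W]
    rw [← DigitToken.sum_pow_exponent hp.pos, ← hW]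
    refine isGreatest_setOf_sum_monic_pow_ne_zero hn hF hM
      (DigitToken.card_exponent_eq_lt hp.pos π) fun t => ?_
    rw [hW, hW]
    exact Function.argmin_le W t
  have h1 := hgreatest 1
  rw [rhoStar_one (Nat.one_lt_pow hn.ne' hp.one_lt)] at h1
  refine ⟨(Set.finite_Iic _).subset h1.2, ?_, h1.csSup_eq.trans (hgreatest ρ).csSup_eq.symm⟩
  have h0 : M 0 = {1} := by
    ext f
    rw [hM, Finset.mem_singleton]
    exact ⟨fun h => h.1.natDegree_eq_zero.mp h.2, by rintro rfl; simp⟩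
  simp [h0]
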